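/- arXiv:1310.7531 — 9 statements merged into one kernel-verified Lean document; each statement's English description precedes it below -/
import Mathlib

section
/- Let (G_n)_{n≥1} be the sequence of polynomials in ℚ[x] defined by G₁(x) = 1 and G_{n+1}(x) = (2n+nx)·G_n(x) + (1+x)²·G_n′(x). For all n ≥ 1 and u ≥ 0, the number of pairs (T, r) where T is a tree on the vertex set Fin n ⊕ Fin u (a connected acyclic simple graph), r is a vertex of T (the root), every non-root vertex of the form inr j has degree at least 3 in T, and if the root r is of the form inr j then r has degree at least 2 in T, equals u! times the coefficient of x^u in G_n(x). -/
open Polynomial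

def RT {V : Type*} (f : V → V) (r : V) : Prop := f r = r ∧ ∀ v, ∃ k, f^[k] v = r

open Classical in
noncomputable def chd {V : Type*} [Fintype V] (f : V → V) (v : V) : ℕ :=
  (Finset.univ.filter (fun w => f w = v ∧ w ≠ v)).card

lemma chd_eq {V : Type*} [Fintype V] [DecidableEq V] (f : V → V) (v : V) :
    chd f v = (Finset.univ.filter (fun w => f w = v ∧ w ≠ v)).card := by
  unfold chd
  congr

lemma RT.inv {V : Type*} {f : V → V} {r : V} (h : RT f r) (P : V → Prop)
    (hP : ∀ v, P v → P (f v)) (v : V) (hv : P v) : P r := by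
  obtain ⟨k, hk⟩ := h.2 v
  rw [← hk]
  clear hk
  induction k with
  | zero => exact hv
  | succ k ih => rw [Function.iterate_succ_apply']; exact hP _ ih

lemma RT.fix {V : Type*} {f : V → V} {r : V} (h : RT f r) {v : V} (hv : f v = v) : v = r :=
  (h.inv (fun w => w = v) (by rintro w rfl; exact hv) v rfl).symm

lemma RT.two {V : Type*} {f : V → V} {r : V} (h : RT f r) {v : V} (hv : f (f v) = v) : v = r := by
  have := h.inv (fun w => w = v ∨ w = f v) (by rintro w (rfl | rfl) <;> simp [hv]) v (Or.inl rfl)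
  rcases this with h1 | h1
  · exact h1.symm
  · apply h.fix
    have := h.1
    rw [h1, hv] at this
    exact this.symm

lemma RT.sum_chd {V : Type*} [Fintype V] {f : V → V} {r : V} (h : RT f r) :
    ∑ v, chd f v + 1 = Fintype.card V := by
  classical
  have h1 : ∑ v, chd f v = (Finset.univ.filter (fun w : V => f w ≠ w)).card := by
    rw [Finset.card_eq_sum_card_fiberwise (f := f) (t := Finset.univ) (by simp)]
    refine Finset.sum_congr rfl fun v _ => ?_
    unfold chd
    rw [Finset.filter_filter]
    congr 1
    ext w
    simp
    grind
  have h2 : (Finset.univ.filter (fun w : V => f w ≠ w)) = Finset.univ.erase r := by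
    ext w
    simp
    constructor
    · rintro h3 rfl; exact h3 h.1
    · intro h3 h4; exact h3 (h.fix h4)
  rw [h1, h2, Finset.card_erase_of_mem (Finset.mem_univ _), Finset.card_univ]
  have : 0 < Fintype.card V := Fintype.card_pos_iff.2 ⟨r⟩
  omega

/-- removal of a leaf -/
lemma RT.leaf {V : Type*} [Fintype V] {f : V → V} {r : V} (h : RT f r) {v : V}
    (hv : chd f v = 0) (hc : 2 ≤ Fintype.card V) : ∀ w, f w ≠ v := by
  classical
  have h1 : ∀ w, f w = v → w = v := by
    intro w hw
    by_contra h2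
    have : w ∈ (Finset.univ.filter (fun w => f w = v ∧ w ≠ v)) := by simp [hw, h2]
    unfold chd at hv
    rw [Finset.card_eq_zero] at hv
    rw [hv] at this
    simp at this
  intro w hw
  obtain rfl := h1 w hw
  obtain rfl := h.fix hw
  obtain ⟨x, hx⟩ := Fintype.exists_ne_of_one_lt_card hc w
  exact h.inv (fun y => y ≠ w) (fun y hy h3 => hy (h1 y h3)) x hx rfl

def extF {V : Type*} [DecidableEq V] (v : V) (g : {w // w ≠ v} → {w // w ≠ v}) (w0 : {w // w ≠ v}) : V → V :=
  fun u => if h : u = v then w0 else g ⟨u, h⟩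

lemma extF_coe {V : Type*} [DecidableEq V] (v : V) (g : {w // w ≠ v} → {w // w ≠ v}) (w0 u : {w // w ≠ v}) :
    extF v g w0 u = g u := by
  unfold extF
  rw [dif_neg u.2]

lemma extF_self {V : Type*} [DecidableEq V] (v : V) (g : {w // w ≠ v} → {w // w ≠ v}) (w0 : {w // w ≠ v}) :
    extF v g w0 v = w0 := by
  simp [extF]

lemma extF_ne {V : Type*} [DecidableEq V] (v : V) (g : {w // w ≠ v} → {w // w ≠ v}) (w0 : {w // w ≠ v}) (u) :
    extF v g w0 u ≠ v := by
  unfold extF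
  split_ifs
  · exact w0.2
  · exact (g _).2

lemma extF_iter {V : Type*} [DecidableEq V] (v : V) (g : {w // w ≠ v} → {w // w ≠ v}) (w0 u : {w // w ≠ v}) (k : ℕ) :
    (extF v g w0)^[k] u = g^[k] u := by
  induction k with
  | zero => rfl
  | succ k ih => rw [Function.iterate_succ_apply', Function.iterate_succ_apply', ih, extF_coe]

lemma extF_RT {V : Type*} [DecidableEq V] (v : V) (g : {w // w ≠ v} → {w // w ≠ v}) (w0 r : {w // w ≠ v}) :
    RT (extF v g w0) r ↔ RT g r := by
  unfold RT
  rw [extF_coe]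
  constructor
  · rintro ⟨h1, h2⟩
    refine ⟨Subtype.ext h1, fun u => ?_⟩
    obtain ⟨k, hk⟩ := h2 u
    rw [extF_iter] at hk
    exact ⟨k, Subtype.ext hk⟩
  · rintro ⟨h1, h2⟩
    have h3 : ∀ u : {w // w ≠ v}, ∃ k, (extF v g w0)^[k] u = r := by
      intro u
      obtain ⟨k, hk⟩ := h2 u
      exact ⟨k, by rw [extF_iter, hk]⟩
    refine ⟨congrArg _ h1, fun u => ?_⟩
    by_cases hu : u = v
    · obtain ⟨k, hk⟩ := h3 w0
      refine ⟨k+1, ?_⟩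
      rw [Function.iterate_succ_apply, hu, extF_self, hk]
    · exact h3 ⟨u, hu⟩

lemma extF_chd_self {V : Type*} [Fintype V] [DecidableEq V] (v : V) (g : {w // w ≠ v} → {w // w ≠ v}) (w0 : {w // w ≠ v}) :
    chd (extF v g w0) v = 0 := by
  unfold chd
  simp [extF_ne]

lemma extF_chd {V : Type*} [Fintype V] [DecidableEq V] (v : V) (g : {w // w ≠ v} → {w // w ≠ v}) (w0 u : {w // w ≠ v}) :
    chd (extF v g w0) u = chd g u + if u = w0 then 1 else 0 := by
  rw [chd_eq, chd_eq]
  have h1 : (Finset.univ.filter (fun w => extF v g w0 w = u ∧ w ≠ u)) =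
      ((Finset.univ.filter (fun w => g w = u ∧ w ≠ u)).map (Function.Embedding.subtype _)) ∪
      (if u = w0 then {v} else ∅) := by
    ext w
    by_cases hw : w = v
    · have hu := u.2
      have h2 : extF v g w0 w = w0 := by rw [hw, extF_self]
      split_ifs with h
      · simp only [Finset.mem_filter, extF_self, h, hw, Finset.mem_union, Finset.mem_singleton]
        simp
        exact fun h' => w0.2 (Eq.symm h')
      · simp only [Finset.mem_filter, extF_self, hw, Finset.mem_union]
        simp
        intro h3
        exact absurd (Subtype.ext h3.symm) h
    · have h2 : extF v g w0 w = g ⟨w, hw⟩ := extF_coe v g w0 ⟨w, hw⟩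
      rw [Finset.mem_filter, h2]
      have h3 : w ∉ (if u = w0 then {v} else ∅ : Finset V) := by
        split_ifs <;> simp [hw]
      simp only [Finset.mem_union, h3, Finset.mem_map, Finset.mem_filter]
      simp [Subtype.ext_iff, hw]
  rw [h1, Finset.card_union_of_disjoint, Finset.card_map]
  · split_ifs <;> simp
  · split_ifs <;> simp

noncomputable def NT (V : Type*) [Fintype V] (c : V → ℕ) : ℕ :=
  Nat.card {p : (V → V) × V // RT p.1 p.2 ∧ chd p.1 = c}

lemma NT_rec {V : Type*} [Fintype V] [DecidableEq V] (c : V → ℕ) (hc : 2 ≤ Fintype.card V) (v : V) (hv : c v = 0) :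
    NT V c = ∑ w0 : {w // w ≠ v}, Nat.card {p : ({w // w ≠ v} → {w // w ≠ v}) × {w // w ≠ v} //
      RT p.1 p.2 ∧ ∀ u, chd p.1 u + (if u = w0 then 1 else 0) = c u} := by
  classical
  rw [← Nat.card_sigma]
  unfold NT
  symm
  refine Nat.card_congr (Equiv.ofBijective (fun q => ⟨(extF v q.2.1.1 q.1, q.2.1.2), ?_, ?_⟩) ⟨?_, ?_⟩)
  · exact (extF_RT _ _ _ _).2 q.2.2.1
  · funext u
    by_cases hu : u = v
    · rw [hu, hv]; exact extF_chd_self _ _ _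
    · exact (extF_chd v _ _ ⟨u, hu⟩).trans (q.2.2.2 ⟨u, hu⟩)
  · rintro ⟨w0, ⟨⟨g, r⟩, h⟩⟩ ⟨w0', ⟨⟨g', r'⟩, h'⟩⟩ heq
    simp only [Subtype.mk.injEq, Prod.mk.injEq] at heq
    obtain ⟨h1, h2⟩ := heq
    obtain rfl := Subtype.ext h2
    have h3 := congrFun h1 v
    rw [extF_self, extF_self] at h3
    obtain rfl := Subtype.ext h3
    obtain rfl : g = g' := by
      funext u
      have := congrFun h1 u
      rw [extF_coe, extF_coe] at this
      exact Subtype.ext this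
    rfl
  · rintro ⟨⟨f, r⟩, h, hch⟩
    simp only at h hch
    have hl := h.leaf (v := v) (by rw [hch, hv]) hc
    have hr : r ≠ v := by rw [← h.1]; exact hl r
    have he : extF v (fun u => ⟨f u, hl u⟩) ⟨f v, hl v⟩ = f := by
      funext u
      unfold extF
      split_ifs with hu
      · rw [hu]
      · rfl
    refine ⟨⟨⟨f v, hl v⟩, ⟨(fun u => ⟨f u, hl u⟩, ⟨r, hr⟩), ?_, ?_⟩⟩, ?_⟩
    · rw [← extF_RT v _ ⟨f v, hl v⟩]
      rw [he]; exact h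
    · intro u
      rw [← extF_chd, he, hch]
    · simp only [Subtype.mk.injEq, Prod.mk.injEq, and_true]
      exact he

lemma NT_eq : ∀ (m : ℕ) (V : Type) [Fintype V] (c : V → ℕ), Fintype.card V = m + 1 → ∑ v, c v = m →
    (NT V c : ℚ) = (m.factorial : ℚ) / ∏ v, ((c v).factorial : ℚ) := by
  classical
  intro m
  induction m with
  | zero =>
    intro V _ c hV hc
    obtain ⟨x, hx⟩ := Fintype.card_eq_one_iff.1 (by simpa using hV)
    have hc0 : ∀ v, c v = 0 := by simpa using hc
    have : NT V c = 1 := by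
      unfold NT
      rw [Nat.card_eq_one_iff_unique]
      constructor
      · constructor
        rintro ⟨⟨f, r⟩, h⟩ ⟨⟨f', r'⟩, h'⟩
        have : f = f' := by funext u; rw [hx (f u), hx (f' u)]
        have : r = r' := by rw [hx r, hx r']
        subst_vars; rfl
      · refine ⟨⟨(id, x), ⟨rfl, fun v => ⟨0, hx v⟩⟩, ?_⟩⟩
        funext u
        rw [hc0]
        unfold chd
        simp
    rw [this]
    simp [hc0]
  | succ m ih =>
    intro V _ c hV hc
    obtain ⟨v, hv⟩ : ∃ v, c v = 0 := by
      by_contra! h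
      have : ∑ v : V, 1 ≤ ∑ v, c v := Finset.sum_le_sum fun v _ => Nat.one_le_iff_ne_zero.2 (h v)
      simp at this
      omega
    have hW : Fintype.card {w // w ≠ v} = m + 1 := by
      simp [Fintype.card_subtype_compl, hV]
    have hsum : ∀ {R : Type} [AddCommMonoid R] (F : V → R), ∑ x, F x = F v + ∑ u : {w // w ≠ v}, F u := by
      intro R _ F
      rw [Fintype.sum_eq_add_sum_compl v]
      congr 1
      apply Finset.sum_subtype
      simp
    have hprod : ∀ (F : V → ℚ), ∏ x, F x = F v * ∏ u : {w // w ≠ v}, F u := by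
      intro F
      rw [Fintype.prod_eq_mul_prod_compl v]
      congr 1
      apply Finset.prod_subtype
      simp
    rw [NT_rec c (by omega) v hv, Nat.cast_sum]
    have hcW : ∑ u : {w // w ≠ v}, c u = m + 1 := by
      rw [hsum, hv] at hc; omega
    have key : ∀ w0 : {w // w ≠ v}, (Nat.card {p : ({w // w ≠ v} → {w // w ≠ v}) × {w // w ≠ v} //
      RT p.1 p.2 ∧ ∀ u, chd p.1 u + (if u = w0 then 1 else 0) = c u} : ℚ) =
        c w0 * (m.factorial / ∏ v, ((c v).factorial : ℚ)) := by
      intro w0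
      rcases Nat.eq_zero_or_pos (c w0) with h0 | h0
      · rw [h0, Nat.cast_zero, zero_mul, Nat.cast_eq_zero, Nat.card_eq_zero]
        left
        constructor
        rintro ⟨p, -, h⟩
        have := h w0
        rw [h0] at this
        simp at this
      · have h1 : Nat.card {p : ({w // w ≠ v} → {w // w ≠ v}) × {w // w ≠ v} //
            RT p.1 p.2 ∧ ∀ u, chd p.1 u + (if u = w0 then 1 else 0) = c u} =
            NT {w // w ≠ v} (fun u => c u - (if u = w0 then 1 else 0)) := by
          unfold NT
          apply Nat.card_congr
          apply Equiv.subtypeEquivRight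
          intro p
          rw [funext_iff]
          apply and_congr_right
          intro _
          apply forall_congr'
          intro u
          split_ifs with h
          · rw [h]; omega
          · simp
        have h2 : ∑ u : {w // w ≠ v}, (c u - (if u = w0 then 1 else 0)) = m := by
          have := Finset.sum_tsub_distrib (Finset.univ : Finset {w // w ≠ v})
            (f := fun u => c u) (g := fun u => if u = w0 then 1 else 0)
            (by intro u _; dsimp; split_ifs with h; (· rw [h]; exact h0); (· omega))
          rw [this, hcW]
          simp
        rw [h1, ih _ _ hW h2, hprod, hv, Fintype.prod_eq_mul_prod_compl w0, Fintype.prod_eq_mul_prod_compl w0]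
        have h3 : ∏ i ∈ ({w0}ᶜ : Finset {w // w ≠ v}), (((c i - (if i = w0 then 1 else 0)).factorial : ℕ) : ℚ) =
          ∏ i ∈ ({w0}ᶜ : Finset {w // w ≠ v}), ((c i).factorial : ℚ) := by
          apply Finset.prod_congr rfl
          intro i hi
          simp at hi
          simp [hi]
        rw [h3]
        have h4 : ∏ i ∈ ({w0}ᶜ : Finset {w // w ≠ v}), ((c i).factorial : ℚ) ≠ 0 := by
          apply Finset.prod_ne_zero_iff.2
          intro i _; positivity
        obtain ⟨d, hd⟩ : ∃ d, c w0 = d + 1 := ⟨c w0 - 1, by omega⟩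
        simp only [hd, if_true, Nat.add_sub_cancel, Nat.factorial_succ]
        push_cast
        have : (d.factorial : ℚ) ≠ 0 := by positivity
        field_simp
        simp
    rw [Finset.sum_congr rfl fun w0 _ => key w0, ← Finset.sum_mul, ← Nat.cast_sum, hcW, Nat.factorial_succ]
    push_cast
    ring

/-- the graph of a parent function -/
def grf {V : Type*} (f : V → V) : SimpleGraph V := SimpleGraph.fromRel (fun a b => f a = b)

lemma grf_adj {V : Type*} (f : V → V) (a b : V) : (grf f).Adj a b ↔ a ≠ b ∧ (f a = b ∨ f b = a) := by
  simp [grf, SimpleGraph.fromRel_adj]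

lemma grf_tree {V : Type*} [Fintype V] {f : V → V} {r : V} (h : RT f r) : (grf f).IsTree := by
  classical
  have hreach : ∀ v, (grf f).Reachable v r := by
    intro v
    obtain ⟨k, hk⟩ := h.2 v
    rw [← hk]
    clear hk
    induction k with
    | zero => exact SimpleGraph.Reachable.refl _
    | succ k ih =>
      rw [Function.iterate_succ_apply']
      refine ih.trans ?_
      by_cases h1 : f^[k] v = f (f^[k] v)
      · rw [← h1]
      · exact SimpleGraph.Adj.reachable ((grf_adj _ _ _).2 ⟨h1, Or.inl rfl⟩)
  have hconn : (grf f).Connected :=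
    { preconnected := fun a b => (hreach a).trans (hreach b).symm
      nonempty := ⟨r⟩ }
  rw [SimpleGraph.isTree_iff_connected_and_card]
  refine ⟨hconn, le_antisymm ?_ hconn.card_vert_le_card_edgeSet_add_one⟩
  have h1 : Nat.card (grf f).edgeSet ≤ Nat.card {v // v ≠ r} := by
    refine Nat.card_le_card_of_surjective
      (fun v => ⟨s(v.1, f v.1), ?_⟩) ?_
    · rw [SimpleGraph.mem_edgeSet, grf_adj]
      exact ⟨fun h2 => v.2 (h.fix h2.symm), Or.inl rfl⟩
    · rintro ⟨e, he⟩
      induction e using Sym2.ind with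
      | _ a b =>
        rw [SimpleGraph.mem_edgeSet, grf_adj] at he
        obtain ⟨hab, h2 | h2⟩ := he
        · refine ⟨⟨a, ?_⟩, ?_⟩
          · rintro rfl; exact hab (h.1.symm.trans h2)
          · simp [h2]
        · refine ⟨⟨b, ?_⟩, ?_⟩
          · rintro rfl; exact hab (h2.symm.trans h.1)
          · simp [h2, Sym2.eq_swap]
  have h2 : Nat.card {v // v ≠ r} + 1 = Nat.card V := by
    rw [Nat.card_eq_fintype_card, Nat.card_eq_fintype_card, Fintype.card_subtype_compl]
    have : 0 < Fintype.card V := Fintype.card_pos_iff.2 ⟨r⟩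
    simp
    omega
  omega

lemma grf_inj {V : Type*} {f g : V → V} {r : V} (hf : RT f r) (hg : RT g r) (h : grf f = grf g) : f = g := by
  funext v
  by_contra hv
  have key : ∀ v, (v ≠ r ∧ f v ≠ g v) → (g v ≠ r ∧ f (g v) ≠ g (g v)) := by
    rintro v ⟨hr, hv⟩
    have h1 : v ≠ g v := fun h2 => hr (hg.fix h2.symm)
    have h2 : (grf f).Adj v (g v) := by rw [h, grf_adj]; exact ⟨h1, Or.inl rfl⟩
    rw [grf_adj] at h2
    have h3 := h2.2.resolve_left hv
    refine ⟨?_, ?_⟩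
    · intro h4
      rw [h4, hf.1] at h3
      exact hr h3.symm
    · rw [h3]
      intro h4
      exact hr (hg.two h4.symm)
  have hr : v ≠ r := by rintro rfl; exact hv (hf.1.trans hg.1.symm)
  exact (hg.inv (fun v => v ≠ r ∧ f v ≠ g v) key v ⟨hr, hv⟩).1 rfl

lemma grf_surj {V : Type*} [Fintype V] {T : SimpleGraph V} (hT : T.IsTree) (r : V) :
    ∃ f, RT f r ∧ grf f = T := by
  classical
  have h1 : ∀ v, ∃ w, v ≠ r → T.Adj v w ∧ T.dist w r < T.dist v r := by
    intro v
    by_cases hv : v = r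
    · exact ⟨v, fun h => absurd hv h⟩
    · obtain ⟨p, hp⟩ := hT.1.exists_walk_length_eq_dist v r
      cases p with
      | nil => exact absurd rfl hv
      | cons hadj q =>
        refine ⟨_, fun _ => ⟨hadj, ?_⟩⟩
        have := SimpleGraph.dist_le q
        rw [SimpleGraph.Walk.length_cons] at hp
        omega
  choose g hg using h1
  have hRT : RT (fun v => if v = r then r else g v) r := by
    refine ⟨by simp, ?_⟩
    have : ∀ d v, T.dist v r ≤ d → ∃ k, (fun v => if v = r then r else g v)^[k] v = r := by
      intro d
      induction d with
      | zero =>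
        intro v hv
        exact ⟨0, (hT.1.dist_eq_zero_iff).1 (Nat.le_zero.1 hv)⟩
      | succ d ih =>
        intro v hv
        by_cases hr : v = r
        · exact ⟨0, hr⟩
        · obtain ⟨k, hk⟩ := ih (g v) (by have := (hg v hr).2; omega)
          refine ⟨k+1, ?_⟩
          rw [Function.iterate_succ_apply]
          simp only [hr, if_false]
          exact hk
    exact fun v => this _ v le_rfl
  refine ⟨_, hRT, ?_⟩
  have hle : grf (fun v => if v = r then r else g v) ≤ T := by
    intro a b hab
    rw [grf_adj] at hab
    obtain ⟨hab, h2 | h2⟩ := hab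
    · split_ifs at h2 with h3
      · exact absurd (h3.trans h2) hab
      · rw [← h2]; exact (hg a h3).1
    · split_ifs at h2 with h3
      · exact absurd (h3.trans h2).symm hab
      · rw [← h2]; exact (hg b h3).1.symm
  exact le_antisymm hle ((SimpleGraph.isTree_iff_minimal_connected.1 hT).2 (grf_tree hRT).1 hle)

lemma grf_deg {V : Type*} [Fintype V] [DecidableEq V] {f : V → V} {r : V} (h : RT f r) (v : V) :
    ((grf f).neighborSet v).ncard = chd f v + if v = r then 0 else 1 := by
  rw [chd_eq]
  have h1 : (grf f).neighborSet v = ↑((Finset.univ.filter (fun w => f w = v ∧ w ≠ v)) ∪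
      (if v = r then ∅ else {f v}) : Finset V) := by
    ext w
    rw [SimpleGraph.mem_neighborSet, grf_adj]
    split_ifs with hv
    · simp only [Finset.union_empty, Finset.coe_filter, Finset.mem_univ, true_and, Set.mem_ofPred_eq]
      have := h.1
      rw [← hv] at this
      rw [this]
      tauto
    · simp only [Finset.coe_union, Finset.coe_filter, Finset.mem_univ, true_and, Finset.coe_singleton,
        Set.mem_union, Set.mem_ofPred_eq, Set.mem_singleton_iff]
      constructor
      · rintro ⟨h2, h3 | h3⟩
        · exact Or.inr h3.symm
        · exact Or.inl ⟨h3, h2.symm⟩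
      · rintro (⟨h2, h3⟩ | h2)
        · exact ⟨h3.symm, Or.inr h2⟩
        · refine ⟨?_, Or.inl h2.symm⟩
          intro h3
          exact hv (h.fix (h3.trans h2).symm)
  rw [h1, Set.ncard_coe_finset, Finset.card_union_of_disjoint]
  · split_ifs <;> simp
  · split_ifs with hv
    · simp
    · simp
      intro h2
      exact absurd (h.two h2) hv

lemma card_greg (n u : ℕ) :
    Nat.card {p : SimpleGraph (Fin n ⊕ Fin u) × (Fin n ⊕ Fin u) //
          p.1.IsTree ∧
          (∀ j : Fin u, Sum.inr j ≠ p.2 → 3 ≤ (p.1.neighborSet (Sum.inr j)).ncard) ∧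
          (∀ j : Fin u, Sum.inr j = p.2 → 2 ≤ (p.1.neighborSet (Sum.inr j)).ncard)} =
    Nat.card {p : ((Fin n ⊕ Fin u) → (Fin n ⊕ Fin u)) × (Fin n ⊕ Fin u) //
      RT p.1 p.2 ∧ ∀ j, 2 ≤ chd p.1 (Sum.inr j)} := by
  symm
  refine Nat.card_congr (Equiv.ofBijective (fun q => ⟨(grf q.1.1, q.1.2), grf_tree q.2.1, ?_, ?_⟩) ⟨?_, ?_⟩)
  · intro j hj
    have := q.2.2 j
    rw [grf_deg q.2.1, if_neg hj]
    omega
  · intro j hj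
    have := q.2.2 j
    rw [grf_deg q.2.1, if_pos hj]
    omega
  · rintro ⟨⟨f, r⟩, h, h'⟩ ⟨⟨f', r'⟩, h2, h2'⟩ heq
    simp only [Subtype.mk.injEq, Prod.mk.injEq] at heq
    obtain ⟨h3, rfl⟩ := heq
    obtain rfl := grf_inj h h2 h3
    rfl
  · rintro ⟨⟨T, r⟩, h, h1, h2⟩
    obtain ⟨f, hf, rfl⟩ := grf_surj h r
    refine ⟨⟨(f, r), hf, ?_⟩, rfl⟩
    intro j
    have h1 := h1 j
    have h2 := h2 j
    simp only [grf_deg hf] at h1 h2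
    by_cases hj : Sum.inr j = r
    · have := h2 hj; rw [if_pos hj] at this; simpa using this
    · have := h1 hj; rw [if_neg hj] at this; simp only; omega

noncomputable def PP : PowerSeries ℚ := PowerSeries.mk fun k => if 2 ≤ k then 1 / (k.factorial : ℚ) else 0

lemma PP_eq : PowerSeries.exp ℚ = PP + 1 + PowerSeries.X := by
  ext k
  rcases k with _ | _ | k
  · simp [PP, PowerSeries.coeff_exp]
  · simp [PP, PowerSeries.coeff_exp, PowerSeries.coeff_one]
  · simp [PP, PowerSeries.coeff_exp, PowerSeries.coeff_one, PowerSeries.coeff_X]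

lemma PP_deriv : PowerSeries.derivative ℚ PP = PP + PowerSeries.X := by
  have h : PP = PowerSeries.exp ℚ - 1 - PowerSeries.X := by rw [PP_eq]; ring
  have h2 : PowerSeries.derivative ℚ PP = PowerSeries.exp ℚ - 1 := by
    rw [h]
    simp [PowerSeries.derivative_exp]
  rw [h2, PP_eq]; ring

noncomputable def aa (n u : ℕ) : ℚ :=
  ((n + u).factorial : ℚ) * PowerSeries.coeff (n + u) (PowerSeries.exp ℚ ^ (n + 1) * PP ^ u)

lemma coeff_deriv (Q : PowerSeries ℚ) (N : ℕ) :
    PowerSeries.coeff (N + 1) Q * (N + 1) = PowerSeries.coeff N (PowerSeries.derivative ℚ Q) := by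
  rw [PowerSeries.coeff_derivative]

lemma aa_rec (n u : ℕ) : aa (n + 1) u = (2 * (n + 1) + 2 * u) * aa n u
    + (n + u) * u * aa n (u - 1) + aa n (u + 1) := by
  set E := PowerSeries.exp ℚ with hE
  have h1 : E ^ (n + 2) * PP ^ u = E ^ (n + 1) * PP ^ (u + 1) + E ^ (n + 1) * PP ^ u
      + (E ^ (n + 1) * PP ^ u) * PowerSeries.X := by
    have : E ^ (n + 2) = E ^ (n + 1) * (PP + 1 + PowerSeries.X) := by rw [← PP_eq, pow_succ]
    rw [this]; ring
  have hf : ((n + u + 1).factorial : ℚ) = (n + u + 1) * ((n + u).factorial : ℚ) := by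
    rw [Nat.factorial_succ]; push_cast; ring
  have h2 : aa (n + 1) u = aa n (u + 1) + (n + u + 1) * aa n u +
      ((n + u).factorial : ℚ) * PowerSeries.coeff (n + u) (PowerSeries.derivative ℚ (E ^ (n + 1) * PP ^ u)) := by
    rw [← coeff_deriv]
    unfold aa
    have e1 : n + 1 + u = n + u + 1 := by ring
    have e2 : n + (u + 1) = n + u + 1 := by ring
    rw [e1, e2, ← hE, show n + 1 + 1 = n + 2 from rfl, h1, map_add, map_add, PowerSeries.coeff_succ_mul_X, hf]
    push_cast
    ring
  have hd : PowerSeries.derivative ℚ (E ^ (n + 1) * PP ^ u) =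
      ((n + 1 + u : ℕ) : PowerSeries ℚ) * (E ^ (n + 1) * PP ^ u) +
      (u : PowerSeries ℚ) * ((E ^ (n + 1) * PP ^ (u - 1)) * PowerSeries.X) := by
    rw [Derivation.leibniz, Derivation.leibniz_pow, Derivation.leibniz_pow, PP_deriv,
      hE, PowerSeries.derivative_exp]
    simp only [smul_eq_mul, nsmul_eq_mul, Nat.add_sub_cancel]
    rcases u with _ | u
    · push_cast; ring
    · push_cast; ring
  rw [h2, hd, map_add]
  have hc : ∀ (k : ℕ) (Q : PowerSeries ℚ) (N : ℕ), PowerSeries.coeff N ((k : PowerSeries ℚ) * Q) = k * PowerSeries.coeff N Q := by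
    intro k Q N
    rw [← nsmul_eq_mul, map_nsmul, nsmul_eq_mul]
  rw [hc, hc]
  rcases u with _ | u
  · unfold aa
    simp
    ring
  · rw [← add_assoc n u 1, PowerSeries.coeff_succ_mul_X]
    unfold aa
    simp only [Nat.add_sub_cancel, ← add_assoc]
    rw [Nat.factorial_succ (n + u)]
    push_cast
    ring

lemma aa_zero (u : ℕ) : aa 0 u = if u = 0 then 1 else 0 := by
  unfold aa
  rcases u with _ | u
  · simp
  · have : PP = PowerSeries.X ^ 2 * PowerSeries.mk (fun k => 1 / ((k + 2).factorial : ℚ)) := by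
      ext k
      rw [PowerSeries.coeff_X_pow_mul']
      unfold PP
      rw [PowerSeries.coeff_mk]
      split_ifs with h
      · rw [PowerSeries.coeff_mk, Nat.sub_add_cancel h]
      · rfl
    rw [this, mul_pow, ← pow_mul, mul_left_comm, PowerSeries.coeff_X_pow_mul', if_neg (by omega)]
    simp

lemma card_aa (n u : ℕ) :
    (Nat.card {p : ((Fin (n + 1) ⊕ Fin u) → (Fin (n + 1) ⊕ Fin u)) × (Fin (n + 1) ⊕ Fin u) //
      RT p.1 p.2 ∧ ∀ j, 2 ≤ chd p.1 (Sum.inr j)} : ℚ) = aa n u := by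
  classical
  let φ : Fin (n + 1) ⊕ Fin u → PowerSeries ℚ := Sum.elim (fun _ => PowerSeries.exp ℚ) (fun _ => PP)
  have hφ : PowerSeries.exp ℚ ^ (n + 1) * PP ^ u = ∏ v, φ v := by
    rw [Fintype.prod_sum_type]
    simp [φ]
  have hcard : Fintype.card (Fin (n + 1) ⊕ Fin u) = n + u + 1 := by simp; ring
  rw [aa, hφ, PowerSeries.coeff_prod, Nat.card_eq_fintype_card, Fintype.card_subtype,
    Finset.card_eq_sum_card_fiberwise (f := fun p => Finsupp.equivFunOnFinite.symm (chd p.1))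
      (t := Finset.finsuppAntidiag Finset.univ (n + u)), Nat.cast_sum, Finset.mul_sum]
  · refine Finset.sum_congr rfl fun l hl => ?_
    have hl : ∑ v, l v = n + u := by simpa [Finset.mem_finsuppAntidiag] using hl
    by_cases hg : ∀ j, 2 ≤ l (Sum.inr j)
    · have h1 := NT_eq (n + u) _ (fun v => l v) hcard hl
      have h2 : ∏ v, PowerSeries.coeff (l v) (φ v) = 1 / ∏ v, ((l v).factorial : ℚ) := by
        rw [one_div, ← Finset.prod_inv_distrib]
        refine Finset.prod_congr rfl fun v _ => ?_
        rcases v with v | v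
        · simp [φ, PowerSeries.coeff_exp]
        · simp [φ, PP, hg v]
      rw [h2, mul_one_div, ← h1, NT, Nat.card_eq_fintype_card, Fintype.card_subtype, Finset.filter_filter]
      congr 2
      ext p
      simp only [Finset.mem_filter, Finset.mem_univ, true_and]
      rw [Equiv.symm_apply_eq]
      constructor
      · rintro ⟨⟨h3, _⟩, h4⟩
        exact ⟨h3, h4⟩
      · rintro ⟨h3, h4⟩
        exact ⟨⟨h3, fun j => by rw [h4]; exact hg j⟩, h4⟩
    · rw [Finset.filter_filter]
      have h1 : (Finset.univ.filter (fun p : ((Fin (n + 1) ⊕ Fin u) → (Fin (n + 1) ⊕ Fin u)) × (Fin (n + 1) ⊕ Fin u) =>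
          (RT p.1 p.2 ∧ ∀ j, 2 ≤ chd p.1 (Sum.inr j)) ∧ Finsupp.equivFunOnFinite.symm (chd p.1) = l)) = ∅ := by
        apply Finset.filter_eq_empty_iff.2
        rintro p - ⟨⟨_, h3⟩, h4⟩
        apply hg
        rw [← h4]
        exact h3
      push Not at hg
      obtain ⟨j, hj⟩ := hg
      rw [h1, Finset.prod_eq_zero (Finset.mem_univ (Sum.inr j))]
      · simp
      · simp [φ, PP, hj]
  · intro p hp
    have hp := (Finset.mem_filter.1 hp).2
    have := hp.1.sum_chd
    rw [hcard] at this
    simp [Finset.mem_finsuppAntidiag]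
    simp at this
    omega


open Polynomial

/-- Rooted Greg trees: pairs `(T, r)` of a tree `T` on `Fin n ⊕ Fin u` together with a
root `r`, where every unlabeled (`inr`) non-root vertex has degree at least 3 and an
unlabeled root has degree at least 2.  Their number is `u!` times the coefficient of
`x^u` in the polynomial `G_n`. -/
theorem stmt_3 (G : ℕ → Polynomial ℚ) (hG1 : G 1 = 1)
    (hGrec : ∀ n : ℕ, 1 ≤ n → G (n + 1) =
      (Polynomial.C (2 * (n : ℚ)) + Polynomial.C (n : ℚ) * Polynomial.X) * G n
        + (1 + Polynomial.X) ^ 2 * Polynomial.derivative (G n)) :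
    ∀ n u : ℕ, 1 ≤ n →
      (Nat.card {p : SimpleGraph (Fin n ⊕ Fin u) × (Fin n ⊕ Fin u) //
          p.1.IsTree ∧
          (∀ j : Fin u, Sum.inr j ≠ p.2 → 3 ≤ (p.1.neighborSet (Sum.inr j)).ncard) ∧
          (∀ j : Fin u, Sum.inr j = p.2 → 2 ≤ (p.1.neighborSet (Sum.inr j)).ncard)} : ℚ)
        = (Nat.factorial u : ℚ) * (G n).coeff u := by

  intro n u hn
  rw [card_greg]
  obtain ⟨n, rfl⟩ : ∃ k, n = k + 1 := ⟨n - 1, by omega⟩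
  rw [card_aa]
  clear hn
  induction n generalizing u with
  | zero =>
    rw [aa_zero, zero_add, hG1, Polynomial.coeff_one]
    split_ifs with h
    · simp [h]
    · simp
  | succ n ih =>
    rw [aa_rec, hGrec (n + 1) (by omega), ih, ih, ih]
    set g := G (n + 1)
    have h1 : (Polynomial.C (2 * ((n + 1 : ℕ) : ℚ)) + Polynomial.C ((n + 1 : ℕ) : ℚ) * Polynomial.X) * g
        + (1 + Polynomial.X) ^ 2 * Polynomial.derivative g =
        Polynomial.C (2 * ((n + 1 : ℕ) : ℚ)) * g + Polynomial.C ((n + 1 : ℕ) : ℚ) * (g * Polynomial.X)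
        + Polynomial.derivative g + Polynomial.C 2 * (Polynomial.derivative g * Polynomial.X)
        + (Polynomial.derivative g * Polynomial.X) * Polynomial.X := by
      have : (Polynomial.C 2 : Polynomial ℚ) = 2 := rfl
      rw [this]; ring
    rw [h1]
    simp only [Polynomial.coeff_add, Polynomial.coeff_C_mul]
    rcases u with _ | _ | u
    · simp [Polynomial.coeff_derivative]
    · simp [Polynomial.coeff_derivative, Polynomial.coeff_mul_X, Nat.factorial]
      ring
    · simp only [Polynomial.coeff_derivative, Polynomial.coeff_mul_X, Nat.factorial_succ,
        Nat.add_sub_cancel]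
      push_cast
      ring
end

section
/- Let (H_n)_{n≥1} be the sequence of polynomials in ℚ[x] defined by H₁(x) = 1 and H_{n+1}(x) = (2n−1+(n−1)x)·H_n(x) + (1+x)²·H_n′(x). For all n ≥ 1 and u ≥ 0, the number of trees T on the vertex set Fin n ⊕ Fin u (connected acyclic simple graphs) such that every vertex of the form inr j has degree at least 3 in T equals u! times the coefficient of x^u in H_n(x). -/
open Polynomial

namespace Greg

/-- Connected graphs with prescribed degrees `d v + 1`. -/
noncomputable def Cn (V : Type) (d : V → ℕ) : ℕ :=
  Nat.card {G : SimpleGraph V // G.Connected ∧ ∀ v, (G.neighborSet v).ncard = d v + 1}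

theorem iso_ncard {V W : Type} {G : SimpleGraph V} {H : SimpleGraph W} (e : G ≃g H) (v : V) :
    (H.neighborSet (e v)).ncard = (G.neighborSet v).ncard := by
  rw [← Nat.card_coe_set_eq, ← Nat.card_coe_set_eq]
  exact (Nat.card_congr (e.mapNeighborSet v)).symm

theorem Cn_congr {V W : Type} (e : V ≃ W) (d : W → ℕ) : Cn V (d ∘ e) = Cn W d := by
  refine Nat.card_congr (Equiv.subtypeEquiv e.simpleGraph ?_)
  intro G
  let i : G ≃g e.simpleGraph G := (SimpleGraph.Iso.comap e.symm G).symm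
  have hi : ∀ v, i v = e v := fun v => rfl
  rw [i.connected_iff]
  refine and_congr_right fun _ => ⟨fun h w => ?_, fun h v => ?_⟩
  · have := h (e.symm w)
    rw [← iso_ncard i, hi] at this
    simpa using this
  · rw [← iso_ncard i, hi, h]; rfl

def attach {W : Type} (S : SimpleGraph W) (w : W) : SimpleGraph (Option W) where
  Adj a b := match a, b with
    | none, none => False
    | none, some x => x = w
    | some x, none => x = w
    | some x, some y => S.Adj x y
  symm := ⟨by
    rintro (_ | a) (_ | b) h
    · exact h
    · exact h
    · exact h
    · exact S.adj_symm h⟩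
  loopless := ⟨by
    rintro (_ | a) h
    · exact h
    · exact S.loopless.irrefl a h⟩

theorem attach_none {W : Type} (S : SimpleGraph W) (w : W) :
    ((attach S w).neighborSet none).ncard = 1 := by
  rw [Set.ncard_eq_one]
  refine ⟨some w, ?_⟩
  ext (_ | x) <;> simp [attach]

theorem attach_some {W : Type} [Finite W] [DecidableEq W] (S : SimpleGraph W) (w x : W) :
    ((attach S w).neighborSet (some x)).ncard = (S.neighborSet x).ncard + if x = w then 1 else 0 := by
  have h1 : (attach S w).neighborSet (some x) = 
     some '' (S.neighborSet x) ∪ if x = w then {none} else ∅ := by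
    split_ifs with h <;> ext (_ | y) <;> simp [attach, h]
  rw [h1, Set.ncard_union_eq, Set.ncard_image_of_injective _ (Option.some_injective W)]
  · split_ifs <;> simp
  · split_ifs <;> simp

theorem attach_connected {W : Type} (S : SimpleGraph W) (w : W) (h : S.Connected) :
    (attach S w).Connected := by
  let f : S →g attach S w := ⟨some, fun {a b} h => h⟩
  have key : ∀ a, (attach S w).Reachable a (some w) := by
    rintro (_ | a)
    · exact SimpleGraph.Adj.reachable (show (attach S w).Adj none (some w) from rfl)
    · exact (h.preconnected a w).map f
  have : Nonempty (Option W) := ⟨none⟩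
  exact SimpleGraph.Connected.mk fun a b => (key a).trans (key b).symm

theorem comap_connected {W : Type} [Finite W] (G : SimpleGraph (Option W)) (h : G.Connected)
    (hd : (G.neighborSet none).ncard = 1) : (G.comap some).Connected := by
  classical
  have := Fintype.ofFinite W
  have hd' : G.degree none = 1 := by
    rw [← SimpleGraph.card_neighborSet_eq_degree, ← Nat.card_eq_fintype_card, Nat.card_coe_set_eq, hd]
  have h2 := h.induce_compl_singleton_of_degree_eq_one hd'
  let f : G.induce {none}ᶜ →g G.comap some :=
    ⟨fun x => x.1.get (Option.isSome_iff_ne_none.2 x.2), by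
      rintro ⟨_ | a, ha⟩ ⟨_ | b, hb⟩ hab
      · simp at ha
      · simp at ha
      · simp at hb
      · exact hab⟩
  exact h2.map f (fun x => ⟨⟨some x, by simp⟩, rfl⟩)

theorem eq_attach {W : Type} (G : SimpleGraph (Option W))
    (hd : (G.neighborSet none).ncard = 1) : ∃ w, G = attach (G.comap some) w := by
  obtain ⟨a, ha⟩ := Set.ncard_eq_one.1 hd
  have h : ∀ b, G.Adj none b ↔ b = a := fun b => by
    rw [← SimpleGraph.mem_neighborSet, ha]; rfl
  rcases a with _ | w
  · exact absurd ((h none).2 rfl) (G.loopless.irrefl _)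
  · refine ⟨w, ?_⟩
    ext (_ | x) (_ | y)
    · simp [attach]
    · simp [attach, h]
    · rw [G.adj_comm]; simp [attach, h]
    · simp [attach]

theorem attach_inj {W : Type} {S S' : SimpleGraph W} {w w' : W} (h : attach S w = attach S' w') :
    w = w' ∧ S = S' := by
  constructor
  · have : (attach S' w').Adj none (some w) := by rw [← h]; exact rfl
    exact this
  · ext x y
    have : (attach S w).Adj (some x) (some y) ↔ (attach S' w').Adj (some x) (some y) := by rw [h]
    exact this

theorem Cn_option {W : Type} [Fintype W] [DecidableEq W] (hW : 2 ≤ Fintype.card W) (d : Option W → ℕ)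
    (h0 : d none = 0) :
    Cn (Option W) d = ∑ w : W, if d (some w) = 0 then 0 else
      Cn W (fun x => d (some x) - if x = w then 1 else 0) := by
  classical
  have : Nontrivial W := Fintype.one_lt_card_iff_nontrivial.1 hW
  let P : W → SimpleGraph W → Prop := fun w S => S.Connected ∧
      ∀ x, (S.neighborSet x).ncard + (if x = w then 1 else 0) = d (some x) + 1
  have hpos : ∀ S : SimpleGraph W, S.Connected → ∀ x, 1 ≤ (S.neighborSet x).ncard := by
    intro S hS x
    have := hS.preconnected.degree_pos_of_nontrivial x
    rwa [← SimpleGraph.card_neighborSet_eq_degree, ← Nat.card_eq_fintype_card,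
      Nat.card_coe_set_eq] at this
  have e1 : Cn (Option W) d = Nat.card (Σ w : W, {S : SimpleGraph W // P w S}) := by
    symm
    refine Nat.card_congr (Equiv.ofBijective (fun p => ⟨attach p.2.1 p.1, 
      attach_connected _ _ p.2.2.1, ?_⟩) ⟨?_, ?_⟩)
    · rintro (_ | x)
      · rw [attach_none, h0]
      · rw [attach_some]; exact p.2.2.2 x
    · rintro ⟨w, S, hS⟩ ⟨w', S', hS'⟩ h
      obtain ⟨rfl, rfl⟩ := attach_inj (congrArg Subtype.val h)
      rfl
    · rintro ⟨G, hG, hd⟩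
      have hn : (G.neighborSet none).ncard = 1 := by rw [hd, h0]
      obtain ⟨w, hw⟩ := eq_attach G hn
      refine ⟨⟨w, G.comap some, comap_connected G hG hn, fun x => ?_⟩, ?_⟩
      · rw [← hd, ← attach_some, ← hw]
      · exact Subtype.ext hw.symm
  rw [e1, Nat.card_sigma]
  refine Finset.sum_congr rfl fun w _ => ?_
  split_ifs with hz
  · rw [Nat.card_eq_zero]
    left
    constructor
    rintro ⟨S, hS, h⟩
    have := hpos S hS w
    have := h w
    simp [hz] at this
    omega
  · unfold Cn
    refine Nat.card_congr (Equiv.subtypeEquivRight fun S => ?_)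
    refine and_congr_right fun hS => forall_congr' fun x => ?_
    dsimp only
    split_ifs with hx
    · subst hx; omega
    · omega

theorem Cn_count (m : ℕ) : ∀ (V : Type) [Fintype V] (d : V → ℕ), Fintype.card V = m + 2 →
    ∑ v, d v = m → Cn V d * ∏ v, (d v).factorial = m.factorial := by
  induction m with
  | zero =>
    intro V _ d hc hs
    have hd : ∀ v, d v = 0 := by simpa using hs
    have : Cn V d = 1 := by
      classical
      have : Nontrivial V := Fintype.one_lt_card_iff_nontrivial.1 (by omega)
      unfold Cn
      rw [Nat.card_eq_one_iff_exists]
      have hco : ∀ G : SimpleGraph V, G.Connected → G = ⊤ := by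
        intro G hG
        ext a b
        simp only [SimpleGraph.top_adj]
        refine ⟨fun h => h.ne, fun hab => ?_⟩
        have hp := hG.preconnected.degree_pos_of_nontrivial a
        rw [SimpleGraph.degree_pos_iff_exists_adj] at hp
        obtain ⟨c, hac⟩ := hp
        have : c = b := by
          by_contra hcb
          have h3 : ({a, b, c} : Finset V).card ≤ Fintype.card V := Finset.card_le_univ _
          rw [Finset.card_eq_three.2 ⟨a, b, c, hab, hac.ne, Ne.symm hcb, rfl⟩] at h3
          omega
        exact this ▸ hac
      refine ⟨⟨⊤, SimpleGraph.connected_top, fun v => ?_⟩, fun y => Subtype.ext (hco _ y.2.1)⟩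
      rw [← Nat.card_coe_set_eq, Nat.card_eq_fintype_card, SimpleGraph.card_neighborSet_eq_degree, hd]
      simp [hc]
    simp [this, hd]
  | succ m ih =>
    intro V _ d hc hs
    obtain ⟨v, hv⟩ : ∃ v, d v = 0 := by
      by_contra! h
      have : ∑ v : V, 1 ≤ ∑ v, d v := Finset.sum_le_sum fun v _ => Nat.one_le_iff_ne_zero.2 (h v)
      simp at this
      omega
    classical
    let W := {x : V // x ≠ v}
    let e : Option W ≃ V := Equiv.optionSubtypeNe v
    have he : e none = v := Equiv.optionSubtypeNe_none v
    have hcW : Fintype.card W = m + 2 := by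
      have := Fintype.card_congr e
      rw [Fintype.card_option] at this
      omega
    let d' := d ∘ e
    have hd'0 : d' none = 0 := by simp [d', he, hv]
    have hs' : ∑ x : W, d' (some x) = m + 1 := by
      rw [← hs, ← Equiv.sum_comp e d, Fintype.sum_option]
      have : d (e none) = 0 := hd'0
      rw [this, zero_add]; rfl
    have hp' : ∏ v, (d v).factorial = ∏ x : W, (d' (some x)).factorial := by
      rw [← Equiv.prod_comp e, Fintype.prod_option]
      have : d (e none) = 0 := hd'0
      rw [this]; simp [d']
    rw [← Cn_congr e, Cn_option (by omega) _ hd'0, hp', Finset.sum_mul]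
    have : ∀ w : W, (if d' (some w) = 0 then 0 else
      Cn W (fun x => d' (some x) - if x = w then 1 else 0)) * ∏ x : W, (d' (some x)).factorial
        = d' (some w) * m.factorial := by
      intro w
      split_ifs with h
      · simp [h]
      · have hsum : ∑ x : W, (d' (some x) - if x = w then 1 else 0) = m := by
          have hh : ∑ x : W, (d' (some x) - if x = w then 1 else 0) + ∑ x : W, (if x = w then 1 else 0) = m + 1 := by
            rw [← Finset.sum_add_distrib, ← hs']
            refine Finset.sum_congr rfl fun x _ => ?_
            split_ifs with hx
            · subst hx; omega
            · omega
          rw [Finset.sum_ite_eq' Finset.univ w] at hh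
          simp only [Finset.mem_univ, if_true] at hh
          omega
        rw [← ih W _ hcW hsum]
        have : ∏ x : W, (d' (some x)).factorial = d' (some w) * ∏ x : W, (d' (some x) - if x = w then 1 else 0).factorial := by
          rw [← Finset.mul_prod_erase _ _ (Finset.mem_univ w), ← Finset.mul_prod_erase _ (fun x : W => (d' (some x) - if x = w then 1 else 0).factorial) (Finset.mem_univ w), ← mul_assoc]
          congr 1
          · simp [Nat.mul_factorial_pred h]
          · refine Finset.prod_congr rfl fun x hx => ?_
            simp [Finset.ne_of_mem_erase hx]
        rw [this]; ring
    rw [Finset.sum_congr rfl fun w _ => this w, ← Finset.sum_mul, hs', Nat.factorial_succ]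

end Greg
namespace Greg

open PowerSeries in
noncomputable def E : PowerSeries ℚ := PowerSeries.exp ℚ - 1 - PowerSeries.X

noncomputable def F (n u : ℕ) : PowerSeries ℚ := PowerSeries.exp ℚ ^ n * E ^ u

theorem F_succ (n u : ℕ) : F (n+1) u = F n u + PowerSeries.X * F n u + F n (u+1) := by
  unfold F E; ring

theorem coeff_F_deriv (n u m : ℕ) : (PowerSeries.coeff (m+2) (F n u)) * (m+2) =
    (n+u) * PowerSeries.coeff (m+1) (F n u) + u * PowerSeries.coeff m (F n (u-1)) := by
  have h : PowerSeries.derivative ℚ (F n u) = ((n+u : ℕ) : ℚ) • F n u + (u:ℚ) • (PowerSeries.X * F n (u-1)) := by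
    have hE : PowerSeries.derivative ℚ E = E + PowerSeries.X := by
      unfold E; simp [PowerSeries.derivative_exp]
    unfold F
    rw [Derivation.leibniz, Derivation.leibniz_pow, Derivation.leibniz_pow, PowerSeries.derivative_exp, hE]
    simp only [smul_eq_mul, nsmul_eq_mul, PowerSeries.smul_eq_C_mul, map_natCast]
    rcases u with _ | u <;> rcases n with _ | n <;> simp only [Nat.cast_zero, Nat.cast_add, Nat.cast_one, zero_mul, mul_zero, Nat.add_sub_cancel, pow_zero] <;> ring
  have h2 := congrArg (PowerSeries.coeff (m+1)) h
  rw [PowerSeries.coeff_derivative] at h2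
  simp [PowerSeries.coeff_succ_X_mul] at h2
  rw [← h2]; ring

theorem coeff_F_deriv0 (n u : ℕ) : (PowerSeries.coeff 1 (F n u)) =
    (n+u) * PowerSeries.coeff 0 (F n u) := by
  have h : PowerSeries.derivative ℚ (F n u) = ((n+u : ℕ) : ℚ) • F n u + (u:ℚ) • (PowerSeries.X * F n (u-1)) := by
    have hE : PowerSeries.derivative ℚ E = E + PowerSeries.X := by
      unfold E; simp [PowerSeries.derivative_exp]
    unfold F
    rw [Derivation.leibniz, Derivation.leibniz_pow, Derivation.leibniz_pow, PowerSeries.derivative_exp, hE]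
    simp only [smul_eq_mul, nsmul_eq_mul, PowerSeries.smul_eq_C_mul, map_natCast]
    rcases u with _ | u <;> rcases n with _ | n <;> simp only [Nat.cast_zero, Nat.cast_add, Nat.cast_one, zero_mul, mul_zero, Nat.add_sub_cancel, pow_zero] <;> ring
  have h2 := congrArg (PowerSeries.coeff 0) h
  rw [PowerSeries.coeff_derivative] at h2
  simpa using h2

theorem coeff_E (k : ℕ) : PowerSeries.coeff k E = if 2 ≤ k then 1 / (k.factorial : ℚ) else 0 := by
  unfold E
  rcases k with _ | _ | k
  · simp
  · simp [PowerSeries.coeff_X, PowerSeries.coeff_one, PowerSeries.coeff_exp]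
  · simp [PowerSeries.coeff_X, PowerSeries.coeff_one, PowerSeries.coeff_exp]

theorem coeff_F_zero (n u m : ℕ) (h : m < 2 * u) : PowerSeries.coeff m (F n u) = 0 := by
  have h1 : (PowerSeries.X : PowerSeries ℚ) ^ 2 ∣ E := by
    rw [PowerSeries.X_pow_dvd_iff]
    intro k hk
    rw [coeff_E, if_neg (by omega)]
  have h2 : (PowerSeries.X : PowerSeries ℚ) ^ (2 * u) ∣ F n u := by
    rw [pow_mul]
    exact (pow_dvd_pow_of_dvd h1 u).mul_left _
  exact PowerSeries.X_pow_dvd_iff.1 h2 m h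

theorem coeff_H (H : ℕ → Polynomial ℚ) (hH1 : H 1 = 1)
    (hHrec : ∀ n : ℕ, 1 ≤ n → H (n + 1) =
      (Polynomial.C (2 * (n : ℚ) - 1) + Polynomial.C ((n : ℚ) - 1) * Polynomial.X) * H n
        + (1 + Polynomial.X) ^ 2 * Polynomial.derivative (H n)) (k : ℕ) : ∀ u : ℕ,
    (Nat.factorial u : ℚ) * (H (k+2)).coeff u = (k+u).factorial * PowerSeries.coeff (k+u) (F (k+2) u) := by
  induction k with
  | zero =>
    intro u
    have h2 : H 2 = 1 := by
      rw [hHrec 1 le_rfl, hH1, derivative_one, Nat.cast_one, show (2 * 1 - 1 : ℚ) = 1 by norm_num, sub_self]; simp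
    rcases u with _ | u
    · simp [h2, F]
    · rw [coeff_F_zero _ _ _ (by omega)]
      simp [h2, Polynomial.coeff_one]
  | succ k ih =>
    intro u
    have e : H (k+1+2) = C (2 * ((k+2 : ℕ) : ℚ) - 1) * H (k+2) + C (((k+2:ℕ) : ℚ) - 1) * (H (k+2) * X)
       + derivative (H (k+2)) + C 2 * (derivative (H (k+2)) * X) + derivative (H (k+2)) * X * X := by
      rw [show k+1+2 = (k+2)+1 from rfl, hHrec (k+2) (by omega)]
      simp only [map_ofNat]; ring
    rw [e]
    simp only [coeff_add, coeff_C_mul, coeff_derivative]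
    have hF : PowerSeries.coeff (k+1+u) (F (k+1+2) u) = PowerSeries.coeff (k+u+1) (F (k+2) u) + 
       PowerSeries.coeff (k+u) (F (k+2) u) + PowerSeries.coeff (k+(u+1)) (F (k+2) (u+1)) := by
      rw [show k+1+2 = (k+2)+1 from rfl, F_succ, show k+1+u=k+u+1 by ring]
      rw [map_add, map_add, PowerSeries.coeff_succ_X_mul]; rfl
    have i1 := ih (u+1)
    have i0 := ih u
    rw [hF]
    have f1 : ((k+1+u).factorial : ℚ) = (k+u+1) * (k+u).factorial := by
      rw [show k+1+u=k+u+1 by ring, Nat.factorial_succ]; push_cast; ring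
    have f2 : ((k+(u+1)).factorial : ℚ) = (k+u+1) * (k+u).factorial := by
      rw [show k+(u+1)=k+u+1 by ring, Nat.factorial_succ]; push_cast; ring
    rcases u with _ | u
    · have hd : PowerSeries.coeff (k+0+1) (F (k+2) 0) * (k+1) = (k+2) * PowerSeries.coeff k (F (k+2) 0) := by
        rcases k with _ | k
        · simpa using coeff_F_deriv0 2 0
        · have := coeff_F_deriv (k+1+2) 0 k
          push_cast at this ⊢
          simp at this ⊢
          linear_combination this
      rw [f1]
      rw [f2] at i1
      simp at i0 i1 hd ⊢
      linear_combination (2*(k:ℚ)+3) * i0 + i1 - k.factorial * hd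
    · have im := ih u
      have hd := coeff_F_deriv (k+2) (u+1) (k+u)
      rw [Nat.add_sub_cancel] at hd
      have g1 : ((k+(u+1)).factorial : ℚ) = (k+u+1) * (k+u).factorial := by
        rw [show k+(u+1)=k+u+1 by ring, Nat.factorial_succ]; push_cast; ring
      rw [f1, g1]
      rw [f2, g1] at i1
      rw [g1] at i0
      rw [Nat.factorial_succ] at i0
      rw [Nat.factorial_succ, Nat.factorial_succ] at i1
      rw [Nat.factorial_succ]
      simp only [coeff_mul_X, coeff_derivative]
      have hx : (derivative (H (k+2)) * X * X).coeff (u+1) = (H (k+2)).coeff u * u := by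
        rw [coeff_mul_X]
        rcases u with _ | u
        · simp
        · rw [coeff_mul_X, coeff_derivative]; push_cast; ring
      rw [coeff_mul_X] at hx
      rw [hx]
      push_cast at *
      rw [show k+(u+1)+1 = k+u+2 by ring] 
      rw [show k+(u+1) = k+u+1 by ring] at i0 ⊢
      linear_combination (2*(k:ℚ)+3+2*(u+1)) * i0 + i1 + (k+u+1) * (u+1) * im - (k+u+1)*(k+u).factorial * hd
end Greg
namespace Greg

theorem ncard_deg {V : Type} [Fintype V] (G : SimpleGraph V) [DecidableRel G.Adj] (v : V) :
    (G.neighborSet v).ncard = G.degree v := by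
  rw [← SimpleGraph.card_neighborSet_eq_degree, ← Nat.card_eq_fintype_card, Nat.card_coe_set_eq]

theorem isTree_iff {V : Type} [Fintype V] (G : SimpleGraph V) :
    G.IsTree ↔ G.Connected ∧ ∑ v, (G.neighborSet v).ncard + 2 = 2 * Fintype.card V := by
  classical
  rw [SimpleGraph.isTree_iff_connected_and_card]
  refine and_congr_right fun _ => ?_
  have h := G.sum_degrees_eq_twice_card_edges
  simp_rw [ncard_deg, h, Nat.card_eq_fintype_card, ← SimpleGraph.edgeFinset_card]
  omega

theorem card_tree (n u m : ℕ) (hm : n + u = m + 2) :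
    (Nat.card {T : SimpleGraph (Fin n ⊕ Fin u) //
          T.IsTree ∧ ∀ j : Fin u, 3 ≤ (T.neighborSet (Sum.inr j)).ncard} : ℚ)
      = m.factorial * PowerSeries.coeff m (F n u) := by
  classical
  let V := Fin n ⊕ Fin u
  have hV : Fintype.card V = m + 2 := by simp [V, hm]
  have : Nontrivial V := Fintype.one_lt_card_iff_nontrivial.1 (by omega)
  have hpos : ∀ S : SimpleGraph V, S.Connected → ∀ x, 1 ≤ (S.neighborSet x).ncard := by
    intro S hS x
    rw [ncard_deg]
    exact hS.preconnected.degree_pos_of_nontrivial x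
  let g : V → PowerSeries ℚ := Sum.elim (fun _ => PowerSeries.exp ℚ) (fun _ => E)
  have hF : F n u = ∏ v : V, g v := by
    simp [V, F, g, Fintype.prod_sum_type]
  rw [hF, PowerSeries.coeff_prod]
  let X := {T : SimpleGraph V // T.IsTree ∧ ∀ j : Fin u, 3 ≤ (T.neighborSet (Sum.inr j)).ncard}
  have : Fintype X := Fintype.ofFinite X
  let φ : X → (V →₀ ℕ) := fun T => Finsupp.equivFunOnFinite.symm fun v => (T.1.neighborSet v).ncard - 1
  have hφ : ∀ T v, φ T v + 1 = (T.1.neighborSet v).ncard := fun T v => by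
    have := hpos T.1 T.2.1.1 v
    change (T.1.neighborSet v).ncard - 1 + 1 = _
    omega
  have hmaps : ∀ T ∈ (Finset.univ : Finset X), φ T ∈ Finset.finsuppAntidiag (Finset.univ : Finset V) m := by
    intro T _
    rw [Finset.mem_finsuppAntidiag]
    refine ⟨?_, Finset.subset_univ _⟩
    have h := ((isTree_iff T.1).1 T.2.1).2
    simp_rw [← hφ, Finset.sum_add_distrib] at h
    simp only [Finset.sum_const, Finset.card_univ, smul_eq_mul, mul_one] at h
    change ∑ v, φ T v = m
    omega
  change ((Nat.card X : ℕ) : ℚ) = _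
  rw [Nat.card_eq_fintype_card, ← Finset.card_univ, Finset.card_eq_sum_card_fiberwise hmaps,
    Nat.cast_sum, Finset.mul_sum]
  refine Finset.sum_congr rfl fun l hl => ?_
  have hsum : ∑ v, l v = m := (Finset.mem_finsuppAntidiag.1 hl).1
  by_cases hall : ∀ j : Fin u, 2 ≤ l (Sum.inr j)
  · have hcard : (Finset.univ.filter fun T : X => φ T = l).card = Cn V l := by
      rw [← Fintype.card_subtype, ← Nat.card_eq_fintype_card]
      refine Nat.card_congr (Equiv.ofBijective (fun T => ⟨T.1.1, T.1.2.1.1, fun v => ?_⟩) ⟨?_, ?_⟩)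
      · rw [← hφ, T.2]
      · intro T T' h
        exact Subtype.ext (Subtype.ext (Subtype.mk.inj h))
      · rintro ⟨G, hG, hd⟩
        have ht : G.IsTree := by
          rw [isTree_iff]
          refine ⟨hG, ?_⟩
          simp_rw [hd, Finset.sum_add_distrib, hsum]
          simp only [Finset.sum_const, Finset.card_univ, smul_eq_mul, mul_one]
          omega
        refine ⟨⟨⟨G, ht, fun j => ?_⟩, ?_⟩, rfl⟩
        · have := hall j
          rw [hd]; omega
        · ext v
          have := hφ ⟨G, ht, fun j => by have := hall j; rw [hd]; omega⟩ v
          have h2 := hd v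
          simp only at this
          omega
    have hc := Cn_count m V l hV hsum
    have hg : ∏ v : V, PowerSeries.coeff (l v) (g v) = ∏ v : V, ((l v).factorial : ℚ)⁻¹ := by
      refine Finset.prod_congr rfl ?_
      rintro (i | j) _
      · simp [g, PowerSeries.coeff_exp]
      · simp [g, coeff_E, hall j]
    rw [hcard, hg, ← hc, Finset.prod_inv_distrib]
    push_cast
    rw [mul_assoc, mul_inv_cancel₀, mul_one]
    exact Finset.prod_ne_zero_iff.2 fun v _ => by exact_mod_cast (l v).factorial_ne_zero
  · push Not at hall
    obtain ⟨j, hj⟩ := hall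
    rw [Finset.prod_eq_zero (Finset.mem_univ (Sum.inr j : V)) (by simp [g, coeff_E, hj]), mul_zero]
    rw [Nat.cast_eq_zero, Finset.card_eq_zero, Finset.filter_eq_empty_iff]
    intro T _ h
    have h1 := T.2.2 j
    have h2 := hφ T (Sum.inr j)
    rw [h] at h2
    omega

end Greg

/-- Greg trees: trees `T` on `Fin n ⊕ Fin u` in which every unlabeled (`inr`) vertex
has degree at least 3.  Their number is `u!` times the coefficient of `x^u` in the
polynomial `H_n`. -/
theorem stmt_4 (H : ℕ → Polynomial ℚ) (hH1 : H 1 = 1)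
    (hHrec : ∀ n : ℕ, 1 ≤ n → H (n + 1) =
      (Polynomial.C (2 * (n : ℚ) - 1) + Polynomial.C ((n : ℚ) - 1) * Polynomial.X) * H n
        + (1 + Polynomial.X) ^ 2 * Polynomial.derivative (H n)) :
    ∀ n u : ℕ, 1 ≤ n →
      (Nat.card {T : SimpleGraph (Fin n ⊕ Fin u) //
          T.IsTree ∧ ∀ j : Fin u, 3 ≤ (T.neighborSet (Sum.inr j)).ncard} : ℚ)
        = (Nat.factorial u : ℚ) * (H n).coeff u := by
  intro n u hn
  obtain rfl | hn2 : n = 1 ∨ 2 ≤ n := by omega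
  · rcases u with _ | u
    · rw [hH1]
      have : Nat.card {T : SimpleGraph (Fin 1 ⊕ Fin 0) //
          T.IsTree ∧ ∀ j : Fin 0, 3 ≤ (T.neighborSet (Sum.inr j)).ncard} = 1 := by
        have hs : Subsingleton (Fin 1 ⊕ Fin 0) := by
          rw [← Fintype.card_le_one_iff_subsingleton]; simp
        have hne : Nonempty (Fin 1 ⊕ Fin 0) := ⟨Sum.inl 0⟩
        rw [Nat.card_eq_one_iff_exists]
        refine ⟨⟨⊥, SimpleGraph.IsTree.of_subsingleton, fun j => j.elim0⟩, fun y => Subtype.ext ?_⟩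
        ext a b
        have : a = b := Subsingleton.elim a b
        subst this
        simp
      rw [this]; simp
    · rw [Greg.card_tree 1 (u+1) u (by omega), Greg.coeff_F_zero _ _ _ (by omega), hH1]
      simp [Polynomial.coeff_one]
  · obtain ⟨k, rfl⟩ := Nat.exists_eq_add_of_le' hn2
    rw [Greg.card_tree (k+2) u (k+u) (by omega), Greg.coeff_H H hH1 hHrec k u]
end

section
/- Let n, u be natural numbers and suppose there exists a tree T on the vertex set Fin n ⊕ Fin u (a connected acyclic simple graph) such that every vertex of the form inr j has degree at least 3 in T. Then u ≤ 2(n+1). -/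
/-- In a Greg tree with `n` labeled vertices (the `inl` part) and `u` unlabeled
vertices (the `inr` part), each unlabeled vertex having degree at least 3,
the number of unlabeled vertices satisfies `u ≤ 2(n+1)`. -/
theorem stmt_5 (n u : ℕ) (T : SimpleGraph (Fin n ⊕ Fin u)) (hT : T.IsTree)
    (hdeg : ∀ j : Fin u, 3 ≤ (T.neighborSet (Sum.inr j)).ncard) :
    u ≤ 2 * (n + 1) := by
  classical
  have h1 := T.sum_degrees_eq_twice_card_edges
  have h2 := hT.card_edgeFinset
  rw [Fintype.sum_sum_type] at h1
  have h3 : ∑ j : Fin u, 3 ≤ ∑ j : Fin u, T.degree (Sum.inr j) := by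
    refine Finset.sum_le_sum fun j _ => ?_
    have h := hdeg j
    rwa [← Nat.card_coe_set_eq, Nat.card_eq_fintype_card, T.card_neighborSet_eq_degree] at h
  simp only [Finset.sum_const, Finset.card_univ, Fintype.card_fin, smul_eq_mul,
    Fintype.card_sum] at h2 h3
  omega
end

section
/- Let T(z) = ∑_{k≥1} k^{k-1} z^k/k! (a real power series convergent for |z| < 1/e), let (G_n)_{n≥1} be the polynomials defined by G₁(x) = 1 and G_{n+1}(x) = (2n+nx)·G_n(x) + (1+x)²·G_n′(x), and set G₀(x) = x/(1+x). Then there exists ε > 0 such that for all real x, u with |x| < ε and |u| < ε, the series ∑_{n≥0} (uⁿ/n!)·G_n(x) converges absolutely and equals T( ((u+x)/(1+x)) · e^{−x/(1+x)} ). -/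
open Polynomial

/-- The tree function `T(z) = ∑_{k≥1} k^{k-1} z^k / k!` as a function on `ℝ`. -/
noncomputable def treeTfun (z : ℝ) : ℝ :=
  ∑' k : ℕ, if k = 0 then 0 else (k : ℝ) ^ (k - 1) * z ^ k / (Nat.factorial k)


noncomputable def tcoef (k : ℕ) : ℝ :=
  if k = 0 then 0 else (k : ℝ) ^ (k - 1) / (Nat.factorial k)

lemma tcoef_nonneg (k : ℕ) : 0 ≤ tcoef k := by
  unfold tcoef; split_ifs <;> positivity

lemma tcoef_le (k : ℕ) : tcoef k ≤ 3 ^ k := by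
  unfold tcoef
  split_ifs with h
  · positivity
  · have hk : (1 : ℝ) ≤ k := by exact_mod_cast Nat.one_le_iff_ne_zero.mpr h
    calc (k : ℝ) ^ (k - 1) / (Nat.factorial k) ≤ (k : ℝ) ^ k / (Nat.factorial k) := by
          gcongr
          exact Nat.sub_le k 1
      _ ≤ Real.exp k := Real.pow_div_factorial_le_exp _ (by positivity) k
      _ = Real.exp 1 ^ k := by rw [← Real.exp_nat_mul]; simp
      _ ≤ 3 ^ k := by
          gcongr
          exact Real.exp_one_lt_three.le

lemma treeT_eq (z : ℝ) : treeTfun z = ∑' k, tcoef k * z ^ k := by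
  unfold treeTfun tcoef
  refine tsum_congr fun k => ?_
  split_ifs <;> ring

noncomputable def tser : FormalMultilinearSeries ℝ ℝ ℝ := FormalMultilinearSeries.ofScalars ℝ tcoef

lemma tser_radius : ((1 / 3 : NNReal) : ENNReal) ≤ tser.radius := by
  refine FormalMultilinearSeries.le_radius_of_bound _ 1 fun n => ?_
  rw [tser, FormalMultilinearSeries.ofScalars_norm, Real.norm_of_nonneg (tcoef_nonneg n)]
  calc tcoef n * ((1 / 3 : NNReal) : ℝ) ^ n ≤ 3 ^ n * ((1 / 3 : NNReal) : ℝ) ^ n := by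
        gcongr; exact tcoef_le n
    _ = 1 := by rw [← mul_pow]; norm_num

lemma tser_sum : tser.sum = treeTfun := by
  ext z
  rw [treeT_eq, FormalMultilinearSeries.sum]
  refine tsum_congr fun k => ?_
  rw [tser, FormalMultilinearSeries.ofScalars_apply_eq]; simp

lemma treeT_fps : HasFPowerSeriesOnBall treeTfun tser 0 ((1 / 3 : NNReal) : ENNReal) := by
  have h0 : (0 : ENNReal) < ((1 / 3 : NNReal) : ENNReal) := by
    rw [ENNReal.coe_pos]; norm_num
  have := tser.hasFPowerSeriesOnBall (h0.trans_le tser_radius)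
  rw [tser_sum] at this
  exact this.mono h0 tser_radius

lemma treeT_analytic (z : ℝ) (hz : |z| < 1 / 3) : AnalyticAt ℝ treeTfun z := by
  refine treeT_fps.analyticAt_of_mem ?_
  rw [Metric.eball_coe]
  simpa using hz

lemma treeT_taylor (w h : ℝ) (hw : |w| + |h| < 1 / 3) :
    HasSum (fun n : ℕ => h ^ n / (Nat.factorial n) * iteratedDeriv n treeTfun w)
      (treeTfun (w + h)) := by
  have hlt : (‖w‖₊ : ENNReal) < ((1 / 3 : NNReal) : ENNReal) := by
    rw [ENNReal.coe_lt_coe, ← NNReal.coe_lt_coe]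
    simp only [coe_nnnorm, Real.norm_eq_abs]
    have := abs_nonneg h
    push_cast; linarith
  have h1 := treeT_fps.changeOrigin hlt
  rw [zero_add, ← ENNReal.coe_sub] at h1
  have h2 := h1.hasSum_iteratedFDeriv (y := h) (by
    rw [Metric.eball_coe]
    have h3 : ‖w‖₊ ≤ 1 / 3 := by exact_mod_cast hlt.le
    simp only [mem_ball_zero_iff, NNReal.coe_sub h3, coe_nnnorm, Real.norm_eq_abs]
    push_cast; linarith)
  suffices hfun : (fun n : ℕ => h ^ n / (Nat.factorial n) * iteratedDeriv n treeTfun w) =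
      (fun n => ((Nat.factorial n : ℝ))⁻¹ • (iteratedFDeriv ℝ n treeTfun w) fun _ => h) by
    rw [hfun]; exact h2
  funext n
  have := (iteratedFDeriv ℝ n treeTfun w).map_smul_univ (fun _ => h) (fun _ => 1)
  simp only [smul_eq_mul, mul_one, Finset.prod_const, Finset.card_univ, Fintype.card_fin] at this
  rw [this, iteratedDeriv_eq_iteratedFDeriv]
  simp only [smul_eq_mul]
  ring

lemma coef_sum (n : ℕ) (hn : 2 ≤ n) :
    ∑ p ∈ Finset.HasAntidiagonal.antidiagonal n, tcoef p.1 * ((-(p.1 : ℝ)) ^ p.2 / (Nat.factorial p.2)) = 0 := by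
  have h := congrFun (fwdDiff_iter_pow_eq_zero_of_lt (R := ℝ) (j := n - 1) (n := n) (by omega)) 0
  rw [fwdDiff_iter_eq_sum_shift] at h
  rw [Finset.Nat.sum_antidiagonal_eq_sum_range_succ_mk]
  have h2 : ∀ k ∈ Finset.range (n + 1),
      tcoef k * ((-(k : ℝ)) ^ (n - k) / (Nat.factorial (n - k)))
      = (1 / (Nat.factorial n : ℝ)) * (((-1 : ℤ) ^ (n - k) * n.choose k) • ((0 : ℝ) + k • (1 : ℝ)) ^ (n - 1)) := by
    intro k hk
    have hkn : k ≤ n := by simpa [Nat.lt_succ_iff] using hk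
    unfold tcoef
    split_ifs with h0
    · subst h0
      have : n - 1 ≠ 0 := by omega
      simp [this]
    · have e : n - 1 = (k - 1) + (n - k) := by omega
      rw [Nat.choose_eq_factorial_div_factorial hkn]
      have hc := Nat.choose_mul_factorial_mul_factorial hkn
      rw [← Nat.choose_eq_factorial_div_factorial hkn]
      have hc' : (n.choose k : ℝ) * k.factorial * (n - k).factorial = n.factorial := by
        exact_mod_cast hc
      have f1 : (k.factorial : ℝ) ≠ 0 := by positivity
      have f2 : ((n - k).factorial : ℝ) ≠ 0 := by positivity
      have f3 : (n.choose k : ℝ) ≠ 0 := by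
        have := Nat.choose_pos hkn
        positivity
      rw [← hc', e, neg_pow, zsmul_eq_mul, pow_add]
      push_cast
      simp only [zero_add, nsmul_eq_mul, mul_one]
      field_simp
  rw [Finset.sum_congr rfl h2, ← Finset.mul_sum, h]
  simp

lemma exp_hasSum (z : ℝ) : HasSum (fun n : ℕ => z ^ n / (Nat.factorial n)) (Real.exp z) := by
  rw [Real.exp_eq_exp_ℝ]
  exact NormedSpace.expSeries_div_hasSum_exp z

lemma exp_small (t : ℝ) (ht : t ≤ 1 / 50) : Real.exp t ≤ 50 / 49 := by
  have h1 := Real.add_one_le_exp (-t)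
  have h2 : Real.exp t * Real.exp (-t) = 1 := by rw [← Real.exp_add]; simp
  have h3 := Real.exp_pos t
  nlinarith

lemma treeT_inv (y : ℝ) (hy : |y| ≤ 1 / 50) : treeTfun (y * Real.exp (-y)) = y := by
  set F : ℕ × ℕ → ℝ := fun p => tcoef p.1 * y ^ p.1 * ((-(p.1 * y)) ^ p.2 / (Nat.factorial p.2))
    with hF
  have hsum : Summable F := by
    rw [← summable_abs_iff]
    have habs : ∀ k j, |F (k, j)| = tcoef k * |y| ^ k * ((k * |y|) ^ j / (Nat.factorial j)) := by
      intro k j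
      simp [hF, abs_mul, abs_div, abs_pow, abs_of_nonneg (tcoef_nonneg k)]
    have hs : ∀ k, HasSum (fun j => |F (k, j)|) (tcoef k * |y| ^ k * Real.exp (k * |y|)) := by
      intro k
      simp only [habs]
      exact (exp_hasSum _).mul_left _
    rw [summable_prod_of_nonneg (fun _ => abs_nonneg _)]
    refine ⟨fun k => (hs k).summable, ?_⟩
    simp only [fun k => (hs k).tsum_eq]
    refine Summable.of_nonneg_of_le (fun k => ?_) (fun k => ?_)
      (summable_geometric_of_lt_one (r := 1 / 2) (by norm_num) (by norm_num))
    · have := tcoef_nonneg k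
      positivity
    · calc tcoef k * |y| ^ k * Real.exp (k * |y|) ≤ 3 ^ k * |y| ^ k * Real.exp (k * |y|) := by
            gcongr; exact tcoef_le k
        _ = (3 * |y| * Real.exp |y|) ^ k := by rw [Real.exp_nat_mul]; ring
        _ ≤ (1 / 2) ^ k := by
            gcongr
            have := exp_small |y| hy
            have h0 := abs_nonneg y
            nlinarith [Real.exp_pos |y|]
  have e1 : ∑' p, F p = treeTfun (y * Real.exp (-y)) := by
    rw [hsum.tsum_prod, treeT_eq]
    refine tsum_congr fun k => ?_
    rw [((exp_hasSum (-(k * y))).mul_left (tcoef k * y ^ k)).tsum_eq, mul_pow, ← Real.exp_nat_mul]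
    ring_nf
  have e2 : ∑' p, F p = y := by
    rw [← (Finset.HasAntidiagonal.sigmaAntidiagonalEquivProd (A := ℕ)).tsum_eq F]
    refine (((Finset.HasAntidiagonal.sigmaAntidiagonalEquivProd (A := ℕ)).summable_iff.mpr hsum).tsum_sigma'
      (fun n => (hasSum_fintype _).summable)).trans ?_
    simp only [Function.comp_apply]
    have h3 : ∀ n : ℕ, (∑' c : Finset.HasAntidiagonal.antidiagonal n,
        F (Finset.HasAntidiagonal.sigmaAntidiagonalEquivProd ⟨n, c⟩)) = if n = 1 then y else 0 := by
      intro n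
      rw [tsum_fintype]
      have : ∑ c : Finset.HasAntidiagonal.antidiagonal n,
          F (Finset.HasAntidiagonal.sigmaAntidiagonalEquivProd ⟨n, c⟩)
          = ∑ p ∈ Finset.HasAntidiagonal.antidiagonal n, F p := by
        exact Finset.sum_coe_sort _ F
      rw [this]
      have h4 : ∑ p ∈ Finset.HasAntidiagonal.antidiagonal n, F p = y ^ n *
        ∑ p ∈ Finset.HasAntidiagonal.antidiagonal n, tcoef p.1 * ((-(p.1 : ℝ)) ^ p.2 / (Nat.factorial p.2)) := by
        rw [Finset.mul_sum]
        refine Finset.sum_congr rfl fun p hp => ?_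
        rw [← Finset.HasAntidiagonal.mem_antidiagonal.mp hp, hF, pow_add]
        simp only
        rw [← neg_mul, mul_pow]
        ring
      rw [h4]
      match n with
      | 0 => simp [tcoef]
      | 1 => rw [Finset.Nat.sum_antidiagonal_eq_sum_range_succ_mk]; simp [tcoef, Finset.sum_range_succ]
      | n + 2 => rw [coef_sum _ (by omega)]; simp
    rw [tsum_congr h3, tsum_ite_eq]
  rw [← e1, e2]

lemma small_y (x : ℝ) (hx : |x| < 1 / 100) : |x / (1 + x)| ≤ 1 / 50 := by
  obtain ⟨h1, h2⟩ := abs_lt.mp hx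
  have : 0 < 1 + x := by linarith
  rw [abs_le, le_div_iff₀ this, div_le_iff₀ this]
  constructor <;> linarith

lemma small_mul_exp (t y : ℝ) (ht : |t| ≤ 1 / 50) (hy : |y| ≤ 1 / 50) :
    |t * Real.exp (-y)| < 1 / 10 := by
  have h1 := exp_small (-y) (by linarith [neg_abs_le y])
  rw [abs_mul, abs_of_pos (Real.exp_pos _)]
  nlinarith [Real.exp_pos (-y), abs_nonneg t]

noncomputable def phi (x : ℝ) : ℝ := x / (1 + x) * Real.exp (-(x / (1 + x)))

lemma hasDerivAt_y (x : ℝ) (hx : 1 + x ≠ 0) :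
    HasDerivAt (fun x : ℝ => x / (1 + x)) (1 / (1 + x) ^ 2) x := by
  have := (hasDerivAt_id x).div ((hasDerivAt_id x).const_add 1) hx
  refine this.congr_deriv ?_
  simp

lemma hasDerivAt_phi (x : ℝ) (hx : 1 + x ≠ 0) :
    HasDerivAt phi (Real.exp (-(x / (1 + x))) / (1 + x) ^ 3) x := by
  have hy := hasDerivAt_y x hx
  have := hy.mul hy.neg.exp
  refine this.congr_deriv ?_
  simp only [Pi.neg_apply]
  field_simp
  ring

lemma step (n : ℕ) (F : ℝ → ℝ) (F' : ℝ) (x : ℝ) (hx : |x| < 1 / 100)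
    (h : ∀ x : ℝ, |x| < 1 / 100 → iteratedDeriv n treeTfun (phi x) = F x)
    (hF : HasDerivAt F F' x) :
    iteratedDeriv (n + 1) treeTfun (phi x)
      = F' * (1 + x) ^ 3 * Real.exp (x / (1 + x)) := by
  have hx1 : 1 + x ≠ 0 := by
    have := (abs_lt.mp hx).1
    intro h; linarith
  have hphi := hasDerivAt_phi x hx1
  have hy := small_y x hx
  have hsm : |phi x| < 1 / 3 := (small_mul_exp _ _ hy hy).trans (by norm_num)
  have hd : HasDerivAt (iteratedDeriv n treeTfun) (iteratedDeriv (n + 1) treeTfun (phi x)) (phi x) := by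
    rw [iteratedDeriv_succ]
    refine DifferentiableAt.hasDerivAt ?_
    rw [iteratedDeriv_eq_iterate]
    exact ((treeT_analytic _ hsm).iterated_deriv n).differentiableAt
  have hc := hd.comp x hphi
  have hF2 : HasDerivAt (iteratedDeriv n treeTfun ∘ phi) F' x := by
    refine hF.congr_of_eventuallyEq ?_
    have : ∀ᶠ z in nhds x, |z| < 1 / 100 := (continuous_abs.isOpen_preimage _ isOpen_Iio).mem_nhds hx
    filter_upwards [this] with z hz
    exact h z hz
  have := hc.unique hF2
  rw [← this, Real.exp_neg]
  have := Real.exp_pos (x / (1 + x))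
  field_simp

lemma deriv_formula (G : ℕ → Polynomial ℚ) (hG1 : G 1 = 1)
    (hGrec : ∀ n : ℕ, 1 ≤ n → G (n + 1) =
      (Polynomial.C (2 * (n : ℚ)) + Polynomial.C (n : ℚ) * Polynomial.X) * G n
        + (1 + Polynomial.X) ^ 2 * Polynomial.derivative (G n)) (n : ℕ) :
    ∀ x : ℝ, |x| < 1 / 100 → iteratedDeriv (n + 1) treeTfun (phi x)
      = Real.exp (x / (1 + x)) ^ (n + 1) * (1 + x) ^ (n + 1) * Polynomial.aeval x (G (n + 1)) := by
  have hne : ∀ x : ℝ, |x| < 1 / 100 → 1 + x ≠ 0 := by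
    intro x hx
    have := (abs_lt.mp hx).1
    intro h; linarith
  induction n with
  | zero =>
    intro x hx
    have := hne x hx
    rw [step 0 (fun x => x / (1 + x)) _ x hx ?_ (hasDerivAt_y x this), hG1]
    · simp; field_simp
    · intro x hx
      rw [iteratedDeriv_zero]
      exact treeT_inv _ (small_y x hx)
  | succ n ih =>
    intro x hx
    have h0 := hne x hx
    have hy := (hasDerivAt_y x h0).exp.pow (n + 1)
    have hp := ((hasDerivAt_id x).const_add 1).pow (n + 1)
    have hg := Polynomial.hasDerivAt_aeval (G (n + 1)) x
    rw [step (n + 1) _ _ x hx ih ((hy.mul hp).mul hg), hGrec (n + 1) (by omega)]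
    simp only [id, map_add, map_mul, map_pow, map_one, Polynomial.aeval_X, Polynomial.aeval_C]
    push_cast
    simp
    field_simp
    ring

theorem stmt_7 (G : ℕ → Polynomial ℚ) (hG1 : G 1 = 1)
    (hGrec : ∀ n : ℕ, 1 ≤ n → G (n + 1) =
      (Polynomial.C (2 * (n : ℚ)) + Polynomial.C (n : ℚ) * Polynomial.X) * G n
        + (1 + Polynomial.X) ^ 2 * Polynomial.derivative (G n)) :
    ∃ ε > (0 : ℝ), ∀ x u : ℝ, |x| < ε → |u| < ε →
      (Summable fun n : ℕ =>
        |u ^ n / (Nat.factorial n) *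
          (if n = 0 then x / (1 + x) else Polynomial.aeval x (G n))|) ∧
      (∑' n : ℕ, u ^ n / (Nat.factorial n) *
          (if n = 0 then x / (1 + x) else Polynomial.aeval x (G n)))
        = treeTfun (((u + x) / (1 + x)) * Real.exp (-x / (1 + x))) := by
  refine ⟨1 / 100, by norm_num, fun x u hx hu => ?_⟩
  have hx1 : 1 + x ≠ 0 := by
    have := (abs_lt.mp hx).1
    intro h; linarith
  have hy := small_y x hx
  have hu2 : |u / (1 + x)| ≤ 1 / 50 := by
    obtain ⟨h1, h2⟩ := abs_lt.mp hx
    obtain ⟨h3, h4⟩ := abs_lt.mp hu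
    have : 0 < 1 + x := by linarith
    rw [abs_le, le_div_iff₀ this, div_le_iff₀ this]
    constructor <;> linarith
  have hw := small_mul_exp _ _ hy hy
  have hh := small_mul_exp _ _ hu2 hy
  have key := treeT_taylor (phi x) (u / (1 + x) * Real.exp (-(x / (1 + x)))) (by
    unfold phi; linarith)
  have hterm : (fun n : ℕ => (u / (1 + x) * Real.exp (-(x / (1 + x)))) ^ n / (Nat.factorial n)
        * iteratedDeriv n treeTfun (phi x)) =
      fun n : ℕ => u ^ n / (Nat.factorial n) *
          (if n = 0 then x / (1 + x) else Polynomial.aeval x (G n)) := by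
    funext n
    match n with
    | 0 =>
      rw [iteratedDeriv_zero, show treeTfun (phi x) = x / (1 + x) from treeT_inv _ hy]
      simp
    | n + 1 =>
      rw [deriv_formula G hG1 hGrec n x hx, if_neg (Nat.succ_ne_zero n), Real.exp_neg,
        mul_pow, div_pow, inv_pow]
      have := Real.exp_pos (x / (1 + x))
      field_simp
  have harg : phi x + u / (1 + x) * Real.exp (-(x / (1 + x)))
      = ((u + x) / (1 + x)) * Real.exp (-x / (1 + x)) := by
    unfold phi
    rw [neg_div]; ring
  rw [hterm, harg] at key
  exact ⟨key.summable.abs, key.tsum_eq⟩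
end

section
/- Let (G_n)_{n≥1} and (H_n)_{n≥1} be the sequences of polynomials in ℚ[x] defined by G₁(x) = H₁(x) = 1, G_{n+1}(x) = (2n+nx)·G_n(x) + (1+x)²·G_n′(x), and H_{n+1}(x) = (2n−1+(n−1)x)·H_n(x) + (1+x)²·H_n′(x). Then for every n ≥ 1, G_n(x) = (n+(n−1)x)·H_n(x) + (x+x²)·H_n′(x). -/
open Polynomial

theorem stmt_11 (G H : ℕ → Polynomial ℚ) (hG1 : G 1 = 1) (hH1 : H 1 = 1)
    (hGrec : ∀ n : ℕ, 1 ≤ n → G (n + 1) =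
      (Polynomial.C (2 * (n : ℚ)) + Polynomial.C (n : ℚ) * Polynomial.X) * G n
        + (1 + Polynomial.X) ^ 2 * Polynomial.derivative (G n))
    (hHrec : ∀ n : ℕ, 1 ≤ n → H (n + 1) =
      (Polynomial.C (2 * (n : ℚ) - 1) + Polynomial.C ((n : ℚ) - 1) * Polynomial.X) * H n
        + (1 + Polynomial.X) ^ 2 * Polynomial.derivative (H n)) :
    ∀ n : ℕ, 1 ≤ n →
      G n = (Polynomial.C (n : ℚ) + Polynomial.C ((n : ℚ) - 1) * Polynomial.X) * H n
        + (Polynomial.X + Polynomial.X ^ 2) * Polynomial.derivative (H n) := by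
  intro n hn
  induction n, hn using Nat.le_induction with
  | base => simp [hG1, hH1]
  | succ n hn ih =>
    rw [hGrec n hn, ih, hHrec n hn]
    simp only [derivative_add, derivative_mul, derivative_C, derivative_X, derivative_pow,
      derivative_one, map_add, map_sub, map_mul, Nat.cast_add, Nat.cast_one, map_one,
      map_ofNat, Nat.cast_ofNat]
    simp
    ring
end

section
/- Let (G_n)_{n≥1} be the sequence of polynomials in ℚ[x] defined by G₁(x) = 1 and G_{n+1}(x) = (2n+nx)·G_n(x) + (1+x)²·G_n′(x), and for each n let G̃_n(x) = G_n(x−1). Then G̃₁(x) = 1, G̃_{n+1}(x) = n(1+x)·G̃_n(x) + x²·G̃_n′(x), every coefficient of G̃_n is nonnegative, and consequently G_n(x) ≥ 0 for all real x with −1 < x < 0. -/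
open Polynomial

theorem stmt_12 (G : ℕ → Polynomial ℚ) (hG1 : G 1 = 1)
    (hGrec : ∀ n : ℕ, 1 ≤ n → G (n + 1) =
      (Polynomial.C (2 * (n : ℚ)) + Polynomial.C (n : ℚ) * Polynomial.X) * G n
        + (1 + Polynomial.X) ^ 2 * Polynomial.derivative (G n)) :
    (G 1).comp (Polynomial.X - 1) = 1 ∧
    (∀ n : ℕ, 1 ≤ n →
      (G (n + 1)).comp (Polynomial.X - 1) =
        Polynomial.C (n : ℚ) * (1 + Polynomial.X) * (G n).comp (Polynomial.X - 1)
          + Polynomial.X ^ 2 * Polynomial.derivative ((G n).comp (Polynomial.X - 1))) ∧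
    (∀ n : ℕ, 1 ≤ n → ∀ k : ℕ, 0 ≤ ((G n).comp (Polynomial.X - 1)).coeff k) ∧
    (∀ n : ℕ, 1 ≤ n → ∀ x : ℝ, -1 < x → x < 0 → 0 ≤ Polynomial.aeval x (G n)) := by
  have h1 : (G 1).comp (Polynomial.X - 1) = 1 := by rw [hG1]; simp
  have h2 : ∀ n : ℕ, 1 ≤ n →
      (G (n + 1)).comp (Polynomial.X - 1) =
        Polynomial.C (n : ℚ) * (1 + Polynomial.X) * (G n).comp (Polynomial.X - 1)
          + Polynomial.X ^ 2 * Polynomial.derivative ((G n).comp (Polynomial.X - 1)) := by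
    intro n hn
    rw [hGrec n hn, Polynomial.derivative_comp]
    simp only [Polynomial.add_comp, Polynomial.mul_comp, Polynomial.pow_comp,
      Polynomial.C_comp, Polynomial.X_comp, Polynomial.one_comp, Polynomial.derivative_sub,
      Polynomial.derivative_X, Polynomial.derivative_one, Polynomial.C_mul]
    have : (Polynomial.C (2 : ℚ)) = 2 := rfl
    rw [this]
    ring
  have h3 : ∀ n : ℕ, 1 ≤ n → ∀ k : ℕ, 0 ≤ ((G n).comp (Polynomial.X - 1)).coeff k := by
    intro n hn
    induction n, hn using Nat.le_induction with
    | base =>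
      intro k
      rw [h1, Polynomial.coeff_one]
      split_ifs <;> norm_num
    | succ n hn ih =>
      intro k
      rw [h2 n hn]
      generalize (G n).comp (Polynomial.X - 1) = P at ih
      rw [mul_assoc, add_mul, one_mul, Polynomial.coeff_add, Polynomial.coeff_C_mul,
        Polynomial.coeff_add, Polynomial.coeff_X_pow_mul']
      have hX : 0 ≤ (Polynomial.X * P).coeff k := by
        cases k with
        | zero => simp
        | succ k => rw [Polynomial.coeff_X_mul]; exact ih k
      have hP := ih k
      have hD : 0 ≤ if 2 ≤ k then (Polynomial.derivative P).coeff (k - 2) else 0 := by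
        split_ifs
        · rw [Polynomial.coeff_derivative]
          exact mul_nonneg (ih _) (by positivity)
        · exact le_refl _
      positivity
  refine ⟨h1, h2, h3, ?_⟩
  intro n hn x hx _
  have h : Polynomial.aeval x (G n)
      = Polynomial.aeval (x + 1) ((G n).comp (Polynomial.X - 1)) := by
    rw [Polynomial.aeval_comp]; simp
  rw [h, Polynomial.aeval_eq_sum_range]
  refine Finset.sum_nonneg fun k _ => ?_
  rw [Algebra.smul_def]
  have hc : (0 : ℝ) ≤ algebraMap ℚ ℝ (((G n).comp (Polynomial.X - 1)).coeff k) := by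
    have := h3 n hn k
    simpa using this
  exact mul_nonneg hc (pow_nonneg (by linarith) _)
end

section
/- Let W : ℝ → ℝ be a function satisfying W(z)·e^{W(z)} = z for all z > 0. Then W(z) > 0 for all z > 0, W is infinitely differentiable on the open interval (0,∞), and for every n ≥ 1 and every z > 0, (−1)^{n−1} times the n-th derivative of W (taken within (0,∞)) at z is nonnegative. In other words, W is a Bernstein function. -/
inductive LamK (W : ℝ → ℝ) : (ℝ → ℝ) → Prop
  | x : LamK W (fun z => Real.exp (-W z))
  | y : LamK W (fun z => (1 + W z)⁻¹)
  | add {f g : ℝ → ℝ} : LamK W f → LamK W g → LamK W (fun z => f z + g z)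
  | mul {f g : ℝ → ℝ} : LamK W f → LamK W g → LamK W (fun z => f z * g z)

theorem lam_pos (W : ℝ → ℝ) (hW : ∀ z : ℝ, 0 < z → W z * Real.exp (W z) = z)
    (z : ℝ) (hz : 0 < z) : 0 < W z := by
  have h := hW z hz
  rw [← h] at hz
  exact pos_of_mul_pos_left hz (Real.exp_pos _).le

theorem lam_lip (W : ℝ → ℝ) (hW : ∀ z : ℝ, 0 < z → W z * Real.exp (W z) = z)
    (a b : ℝ) (ha : 0 < a) (hb : 0 < b) (h : W b ≤ W a) : W a - W b ≤ a - b := by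
  have h1 := hW a ha
  have h2 := hW b hb
  have h3 := lam_pos W hW a ha
  have h4 := lam_pos W hW b hb
  have h5 : Real.exp (W b) ≤ Real.exp (W a) := Real.exp_le_exp.2 h
  have h6 : 1 ≤ Real.exp (W a) := Real.one_le_exp h3.le
  nlinarith [mul_nonneg (sub_nonneg.2 h) (sub_nonneg.2 h6), mul_nonneg h4.le (sub_nonneg.2 h5)]

theorem lam_deriv (W : ℝ → ℝ) (hW : ∀ z : ℝ, 0 < z → W z * Real.exp (W z) = z)
    (z : ℝ) (hz : 0 < z) : HasDerivAt W (Real.exp (-W z) * (1 + W z)⁻¹) z := by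
  have hp := lam_pos W hW z hz
  have hc : ContinuousAt W z := by
    rw [Metric.continuousAt_iff]
    intro ε hε
    refine ⟨min ε z, lt_min hε hz, fun {b} hb => ?_⟩
    rw [Real.dist_eq, lt_min_iff, abs_lt, abs_lt] at hb
    have hb0 : 0 < b := by linarith [hb.2.1]
    rw [Real.dist_eq, abs_lt]
    rcases le_total (W b) (W z) with h | h
    · have := lam_lip W hW z b hz hb0 h
      constructor <;> linarith [hb.1.1]
    · have := lam_lip W hW b z hb0 hz h
      constructor <;> linarith [hb.1.2]
  have hd : HasDerivAt (fun w => w * Real.exp w)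
      (1 * Real.exp (W z) + W z * Real.exp (W z)) (W z) :=
    (hasDerivAt_id (W z)).mul (Real.hasDerivAt_exp (W z))
  have hne : (1 * Real.exp (W z) + W z * Real.exp (W z)) ≠ 0 := by positivity
  have := HasDerivAt.of_local_left_inverse hc hd hne
    (by filter_upwards [Ioi_mem_nhds hz] with y hy using hW y hy)
  refine this.congr_deriv ?_
  symm
  rw [Real.exp_neg, ← mul_inv]
  congr 1
  ring

theorem lam_nonneg (W : ℝ → ℝ) (hW : ∀ z : ℝ, 0 < z → W z * Real.exp (W z) = z)
    (f : ℝ → ℝ) (hf : LamK W f) (z : ℝ) (hz : 0 < z) : 0 ≤ f z := by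
  have hp := lam_pos W hW z hz
  induction hf with
  | x => positivity
  | y => positivity
  | add _ _ h1 h2 => exact add_nonneg h1 h2
  | mul _ _ h1 h2 => exact mul_nonneg h1 h2

theorem lam_step (W : ℝ → ℝ) (hW : ∀ z : ℝ, 0 < z → W z * Real.exp (W z) = z)
    (f : ℝ → ℝ) (hf : LamK W f) :
    ∃ g, LamK W g ∧ ∀ z, 0 < z → HasDerivAt f (-g z) z := by
  induction hf with
  | x =>
    refine ⟨_, LamK.mul .x (LamK.mul .x .y), fun z hz => ?_⟩
    refine (lam_deriv W hW z hz).fun_neg.exp.congr_deriv ?_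
    ring
  | y =>
    refine ⟨_, LamK.mul (LamK.mul .x .y) (LamK.mul .y .y), fun z hz => ?_⟩
    have hp := lam_pos W hW z hz
    have hne : 1 + W z ≠ 0 := by positivity
    refine (((lam_deriv W hW z hz).const_add 1).fun_inv hne).congr_deriv ?_
    field_simp
  | @add f g _ _ h1 h2 =>
    obtain ⟨f', kf, hf⟩ := h1
    obtain ⟨g', kg, hg⟩ := h2
    refine ⟨_, LamK.add kf kg, fun z hz => ?_⟩
    refine ((hf z hz).fun_add (hg z hz)).congr_deriv ?_
    ring
  | @mul f g k1 k2 h1 h2 =>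
    obtain ⟨f', kf, hf⟩ := h1
    obtain ⟨g', kg, hg⟩ := h2
    refine ⟨_, LamK.add (LamK.mul kf k2) (LamK.mul k1 kg), fun z hz => ?_⟩
    refine ((hf z hz).fun_mul (hg z hz)).congr_deriv ?_
    ring

theorem lam_iter (W : ℝ → ℝ) (hW : ∀ z : ℝ, 0 < z → W z * Real.exp (W z) = z) (n : ℕ) :
    ∃ f, LamK W f ∧ ∀ z, 0 < z →
      iteratedDerivWithin (n + 1) W (Set.Ioi 0) z = (-1) ^ n * f z := by
  induction n with
  | zero =>
    refine ⟨_, LamK.mul .x .y, fun z hz => ?_⟩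
    rw [zero_add, iteratedDerivWithin_one, 
      (lam_deriv W hW z hz).hasDerivWithinAt.derivWithin (uniqueDiffOn_Ioi 0 z hz)]
    simp
  | succ n ih =>
    obtain ⟨f, kf, hf⟩ := ih
    obtain ⟨g, kg, hg⟩ := lam_step W hW f kf
    refine ⟨g, kg, fun z hz => ?_⟩
    rw [iteratedDerivWithin_succ, derivWithin_congr (s := Set.Ioi 0) (f := fun z => (-1) ^ n * f z)
      (fun y hy => hf y hy) (hf z hz),
      ((hg z hz).const_mul _).hasDerivWithinAt.derivWithin (uniqueDiffOn_Ioi 0 z hz)]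
    ring

/-- The Lambert W function (determined on `(0,∞)` by `W(z)·e^{W(z)} = z`) is a
Bernstein function: it is positive, smooth on `(0,∞)`, and its derivatives
alternate in sign. -/
theorem stmt_13 (W : ℝ → ℝ) (hW : ∀ z : ℝ, 0 < z → W z * Real.exp (W z) = z) :
    (∀ z : ℝ, 0 < z → 0 < W z) ∧
    ContDiffOn ℝ (⊤ : ℕ∞) W (Set.Ioi 0) ∧
    (∀ n : ℕ, 1 ≤ n → ∀ z : ℝ, 0 < z →
      0 ≤ (-1 : ℝ) ^ (n - 1) * iteratedDerivWithin n W (Set.Ioi 0) z) := by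
  refine ⟨lam_pos W hW, ?_, ?_⟩
  · apply contDiffOn_of_differentiableOn_deriv
    intro m _
    rcases m with _ | n
    · rw [iteratedDerivWithin_zero]
      exact fun z hz => (lam_deriv W hW z hz).differentiableAt.differentiableWithinAt
    · obtain ⟨f, kf, hf⟩ := lam_iter W hW n
      obtain ⟨g, kg, hg⟩ := lam_step W hW f kf
      refine DifferentiableOn.congr (f := fun z => (-1) ^ n * f z) ?_ (fun y hy => hf y hy)
      exact fun z hz => ((hg z hz).const_mul _).differentiableAt.differentiableWithinAt
  · intro n hn z hz
    obtain ⟨n, rfl⟩ : ∃ k, n = k + 1 := ⟨n - 1, by omega⟩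
    obtain ⟨f, kf, hf⟩ := lam_iter W hW n
    rw [hf z hz, Nat.add_sub_cancel, ← mul_assoc, ← mul_pow]
    simpa using lam_nonneg W hW f kf z hz
end

section
/- Let W : ℝ → ℝ be a function satisfying W(z)·e^{W(z)} = z for all z > 0, and define g(z) = W(z)/(1 + W(z)). Then g(z) > 0 for all z > 0, g is infinitely differentiable on (0,∞), and for every n ≥ 1 and every z > 0, (−1)^{n−1} times the n-th derivative of g (taken within (0,∞)) at z is nonnegative. In other words, W/(1+W) (which equals 1 − T₀(−z), where T₀(z) = ∑_{k≥1} k^k z^k/k!) is a Bernstein function. -/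
inductive LamS (W : ℝ → ℝ) : (ℝ → ℝ) → Prop
  | base (c a : ℝ) (k : ℕ) (hc : 0 ≤ c) (ha : 0 ≤ a) :
      LamS W (fun z => c * Real.exp (-(a * W z)) * ((1 + W z)⁻¹) ^ (k + 1))
  | add (f g : ℝ → ℝ) (hf : LamS W f) (hg : LamS W g) : LamS W (fun z => f z + g z)

theorem lam_mono {a b : ℝ} (ha : 0 < a) (h : a ≤ b) : a * Real.exp a ≤ b * Real.exp b := by
  have hb : 0 ≤ b := ha.le.trans h
  gcongr

theorem lam_inj {a b : ℝ} (ha : 0 < a) (hb : 0 < b) (h : a * Real.exp a = b * Real.exp b) :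
    a = b := by
  rcases lt_trichotomy a b with h1 | h1 | h1
  · have : a * Real.exp a < b * Real.exp b := by gcongr
    linarith
  · exact h1
  · have : b * Real.exp b < a * Real.exp a := by gcongr
    linarith

theorem lam_S_deriv (W : ℝ → ℝ) (hW : ∀ z : ℝ, 0 < z → W z * Real.exp (W z) = z)
    (f : ℝ → ℝ) (hf : LamS W f) :
    ∃ g, LamS W g ∧ ∀ z, 0 < z → HasDerivAt f (-g z) z := by
  induction hf with
  | base c a k hc ha =>
    refine ⟨_, LamS.add _ _ (LamS.base (c * a) (a + 1) (k + 1) (by positivity) (by positivity))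
      (LamS.base (c * (k + 1)) (a + 1) (k + 2) (by positivity) (by positivity)), ?_⟩
    intro z hz
    have hd := lam_deriv W hW z hz
    have hpz := lam_pos W hW z hz
    have h1 := (((hd.const_mul a).fun_neg).exp).const_mul c
    have h2 := ((hd.const_add 1).fun_inv (by positivity)).fun_pow (k + 1)
    refine (h1.fun_mul h2).congr_deriv ?_
    have e : Real.exp (-((a + 1) * W z)) = Real.exp (-(a * W z)) * Real.exp (-W z) := by
      rw [← Real.exp_add]; congr 1; ring
    simp only [e, Nat.add_sub_cancel, div_eq_mul_inv, ← inv_pow]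
    push_cast
    ring
  | add f g _ _ ihf ihg =>
    obtain ⟨f', hf', hf⟩ := ihf
    obtain ⟨g', hg', hg⟩ := ihg
    refine ⟨_, LamS.add _ _ hf' hg', fun z hz => ?_⟩
    exact ((hf z hz).fun_add (hg z hz)).congr_deriv (by ring)

theorem lam_S_nonneg (W : ℝ → ℝ) (hW : ∀ z : ℝ, 0 < z → W z * Real.exp (W z) = z)
    (f : ℝ → ℝ) (hf : LamS W f) (z : ℝ) (hz : 0 < z) : 0 ≤ f z := by
  induction hf with
  | base c a k hc ha =>
    have hpz := lam_pos W hW z hz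
    positivity
  | add f g _ _ ihf ihg => exact add_nonneg ihf ihg

theorem lam_S_contDiff (W : ℝ → ℝ) (hW : ∀ z : ℝ, 0 < z → W z * Real.exp (W z) = z)
    (n : ℕ) : ∀ f, LamS W f → ContDiffOn ℝ n f (Set.Ioi 0) := by
  induction n with
  | zero =>
    intro f hf
    obtain ⟨g, hg, h⟩ := lam_S_deriv W hW f hf
    exact contDiffOn_zero.mpr fun z hz => (h z hz).continuousAt.continuousWithinAt
  | succ n ih =>
    intro f hf
    obtain ⟨g, hg, h⟩ := lam_S_deriv W hW f hf
    push_cast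
    rw [contDiffOn_succ_iff_derivWithin (uniqueDiffOn_Ioi 0)]
    refine ⟨fun z hz => (h z hz).differentiableAt.differentiableWithinAt, by simp, ?_⟩
    exact (ih g hg).neg.congr fun z hz =>
      (h z hz).hasDerivWithinAt.derivWithin (uniqueDiffOn_Ioi 0 z hz)

theorem lam_S_sign (W : ℝ → ℝ) (hW : ∀ z : ℝ, 0 < z → W z * Real.exp (W z) = z)
    (n : ℕ) : ∀ f, LamS W f → ∀ z, 0 < z →
      0 ≤ (-1 : ℝ) ^ n * iteratedDerivWithin n f (Set.Ioi 0) z := by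
  induction n with
  | zero =>
    intro f hf z hz
    simpa using lam_S_nonneg W hW f hf z hz
  | succ n ih =>
    intro f hf z hz
    obtain ⟨g, hg, h⟩ := lam_S_deriv W hW f hf
    have hE : Set.EqOn (derivWithin f (Set.Ioi 0)) (fun z => -g z) (Set.Ioi 0) := fun z hz =>
      (h z hz).hasDerivWithinAt.derivWithin (uniqueDiffOn_Ioi 0 z hz)
    rw [iteratedDerivWithin_succ', iteratedDerivWithin_congr hE hz, iteratedDerivWithin_fun_neg]
    have := ih g hg z hz
    rw [pow_succ]
    linarith

/-- If `W` is the Lambert W function on `(0,∞)`, then `g = W/(1+W)`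
(= `1 − T₀(−z)`, where `T₀(z) = ∑_{k≥1} k^k z^k/k!`) is a Bernstein function. -/
theorem stmt_15 (W : ℝ → ℝ) (hW : ∀ z : ℝ, 0 < z → W z * Real.exp (W z) = z) :
    (∀ z : ℝ, 0 < z → 0 < W z / (1 + W z)) ∧
    ContDiffOn ℝ (⊤ : ℕ∞) (fun z => W z / (1 + W z)) (Set.Ioi 0) ∧
    (∀ n : ℕ, 1 ≤ n → ∀ z : ℝ, 0 < z →
      0 ≤ (-1 : ℝ) ^ (n - 1) *
        iteratedDerivWithin n (fun z => W z / (1 + W z)) (Set.Ioi 0) z) := by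
  have hp := lam_pos W hW
  have hS := LamS.base (W := W) 1 1 2 (by norm_num) (by norm_num)
  have hd : ∀ z, 0 < z → HasDerivAt (fun z => W z / (1 + W z))
      (1 * Real.exp (-(1 * W z)) * ((1 + W z)⁻¹) ^ (2 + 1)) z := by
    intro z hz
    have hpz := hp z hz
    have h := lam_deriv W hW z hz
    refine (h.fun_div (h.const_add 1) (by positivity)).congr_deriv ?_
    rw [one_mul, one_mul, inv_pow]
    field_simp
    ring
  have hE : Set.EqOn (derivWithin (fun z => W z / (1 + W z)) (Set.Ioi 0))
      (fun z => 1 * Real.exp (-(1 * W z)) * ((1 + W z)⁻¹) ^ (2 + 1)) (Set.Ioi 0) := fun z hz =>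
    (hd z hz).hasDerivWithinAt.derivWithin (uniqueDiffOn_Ioi 0 z hz)
  refine ⟨fun z hz => ?_, ?_, ?_⟩
  · have := hp z hz
    positivity
  · rw [contDiffOn_infty_iff_derivWithin (uniqueDiffOn_Ioi 0)]
    refine ⟨fun z hz => (hd z hz).differentiableAt.differentiableWithinAt, ?_⟩
    exact (contDiffOn_infty.mpr fun n => lam_S_contDiff W hW n _ hS).congr hE
  · intro n hn z hz
    obtain ⟨m, rfl⟩ : ∃ m, n = m + 1 := ⟨n - 1, by omega⟩
    rw [iteratedDerivWithin_succ', iteratedDerivWithin_congr hE hz, Nat.add_sub_cancel]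
    exact lam_S_sign W hW m _ hS z hz
end

section
/- Let Ω = ℂ \ (−∞, −1/e] = { z ∈ ℂ : Im z ≠ 0 or Re z > −1/e }. There exists a function f : ℂ → ℂ that is holomorphic on Ω, satisfies f(z)·e^{f(z)} = z for all z ∈ Ω, satisfies f(z) ∈ (0,∞) ⊂ ℝ for every real z > 0, and maps the open upper half-plane ℍ⁺ = { z : Im z > 0 } into itself (Im f(z) > 0 whenever Im z > 0). In other words, the principal branch of the Lambert W function extends holomorphically to ℂ \ (−∞,−1/e] and is a Nevanlinna–Pick function, so W is a complete Bernstein function. -/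
open Filter Topology

namespace LW

noncomputable def h (w : ℂ) : ℂ := w * Complex.exp w

def D : Set ℂ := {w | |w.im| < Real.pi ∧ 0 < Real.cos w.im + w.re * Real.sinc w.im}

def Om : Set ℂ := {z : ℂ | z.im ≠ 0 ∨ -(Real.exp 1)⁻¹ < z.re}

lemma mul_sinc (v : ℝ) : v * Real.sinc v = Real.sin v := by
  by_cases hv : v = 0
  · simp [hv]
  · rw [Real.sinc_of_ne_zero hv]; field_simp

lemma sinc_abs (v : ℝ) : Real.sinc |v| = Real.sinc v := by
  rcases abs_choice v with h | h <;> rw [h]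
  exact Real.sinc_neg v

lemma sinc_pos {v : ℝ} (hv : |v| < Real.pi) : 0 < Real.sinc v := by
  by_cases h0 : v = 0
  · simp [h0]
  · have h1 : 0 < |v| := abs_pos.mpr h0
    have := Real.sin_pos_of_pos_of_lt_pi h1 hv
    rw [← mul_sinc, sinc_abs] at this
    exact (pos_iff_pos_of_mul_pos this).mp h1

lemma cos_le_sinc {v : ℝ} (hv : |v| < Real.pi) : Real.cos v ≤ Real.sinc v := by
  by_cases h0 : v = 0
  · simp [h0]
  have h1 : 0 < |v| := abs_pos.mpr h0
  rw [← Real.cos_abs]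
  rcases lt_or_ge |v| (Real.pi / 2) with h2 | h2
  · have hc := Real.cos_pos_of_mem_Ioo (x := |v|) ⟨by linarith [Real.pi_pos], h2⟩
    have ht := Real.lt_tan h1 h2
    rw [Real.tan_eq_sin_div_cos, lt_div_iff₀ hc, ← mul_sinc, sinc_abs] at ht
    exact (lt_of_mul_lt_mul_left ht h1.le).le
  · have := Real.cos_nonpos_of_pi_div_two_le_of_le h2 (by linarith)
    linarith [sinc_pos hv]

lemma re_ge {u v : ℝ} (hv : |v| < Real.pi) (h : 0 ≤ Real.cos v + u * Real.sinc v) : -1 ≤ u := by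
  have h1 := sinc_pos hv
  have h2 := cos_le_sinc hv
  by_contra hu
  push Not at hu
  nlinarith

lemma re_gt {u v : ℝ} (hv : |v| < Real.pi) (h : 0 < Real.cos v + u * Real.sinc v) : -1 < u := by
  have h1 := sinc_pos hv
  have h2 := cos_le_sinc hv
  by_contra hu
  push Not at hu
  nlinarith

lemma h_im (w : ℂ) : (h w).im =
    Real.exp w.re * (w.im * (Real.cos w.im + w.re * Real.sinc w.im)) := by
  have := mul_sinc w.im
  simp only [h, Complex.mul_im, Complex.exp_re, Complex.exp_im]
  rw [← this]; ring

lemma h_re (w : ℂ) : (h w).re =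
    Real.exp w.re * (w.re * Real.cos w.im - w.im * Real.sin w.im) := by
  simp only [h, Complex.mul_re, Complex.exp_re, Complex.exp_im]
  ring

lemma isOpen_D : IsOpen D := by
  have c1 : Continuous (fun w : ℂ => |w.im|) := by fun_prop
  have c2 : Continuous (fun w : ℂ => Real.cos w.im + w.re * Real.sinc w.im) := by
    have := Real.continuous_sinc
    fun_prop
  exact (isOpen_lt c1 continuous_const).inter (isOpen_lt continuous_const c2)

lemma strict (w : ℂ) : HasStrictDerivAt h ((1 + w) * Complex.exp w) w := by
  have := (hasStrictDerivAt_id w).mul (Complex.hasStrictDerivAt_exp w)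
  have h2 : HasStrictDerivAt h (1 * Complex.exp w + w * Complex.exp w) w := this
  exact h2.congr_deriv (by ring)

lemma deriv_ne {w : ℂ} (hw : w ∈ D) : (1 + w) * Complex.exp w ≠ 0 := by
  refine mul_ne_zero ?_ (Complex.exp_ne_zero _)
  intro h0
  have := congrArg Complex.re h0
  have h1 := re_gt hw.1 hw.2
  simp at this
  linarith

lemma real_strictMono : StrictMonoOn (fun u : ℝ => u * Real.exp u) (Set.Ici (-1)) := by
  apply strictMonoOn_of_deriv_pos (convex_Ici _) (by fun_prop)
  intro x hx
  rw [interior_Ici] at hx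
  have := ((hasDerivAt_id x).mul (Real.hasDerivAt_exp x)).deriv
  have h2 : deriv (fun u : ℝ => u * Real.exp u) x = 1 * Real.exp x + x * Real.exp x := this
  rw [h2]
  have h3 := Real.exp_pos x
  have h4 : -1 < x := hx
  nlinarith

lemma maps {w : ℂ} (hw : w ∈ D) : h w ∈ Om := by
  by_cases h0 : w.im = 0
  · right
    have h1 := re_gt hw.1 hw.2
    have := real_strictMono (a := -1) (b := w.re) (by simp) h1.le h1
    rw [h_re, h0]
    simp [Real.exp_neg] at this ⊢
    linarith
  · left
    rw [h_im]
    exact mul_ne_zero (Real.exp_pos _).ne' (mul_ne_zero h0 hw.2.ne')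

/-- boundary values -/
lemma bdry {w : ℂ} (hv : |w.im| < Real.pi) (h0 : Real.cos w.im + w.re * Real.sinc w.im = 0) :
    h w ∉ Om := by
  have hs := sinc_pos hv
  have hu := re_ge hv h0.ge
  have him : (h w).im = 0 := by rw [h_im, h0]; ring
  have hre : (h w).re * Real.sinc w.im = - Real.exp w.re := by
    have h1 := mul_sinc w.im
    have h2 := Real.sin_sq_add_cos_sq w.im
    rw [h_re]
    have h3 : w.re * Real.sinc w.im = - Real.cos w.im := by linarith
    calc _ = Real.exp w.re * ((w.re * Real.sinc w.im) * Real.cos w.im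
              - (w.im * Real.sinc w.im) * Real.sin w.im) := by ring
      _ = - Real.exp w.re * (Real.sin w.im ^ 2 + Real.cos w.im ^ 2) := by rw [h3, h1]; ring
      _ = _ := by rw [h2]; ring
  rintro (h1 | h1)
  · exact h1 him
  · have h2 : (Real.exp 1)⁻¹ ≤ Real.exp w.re := by
      rw [← Real.exp_neg]; exact Real.exp_le_exp.mpr hu
    have h3 := Real.sinc_le_one w.im
    have h4 : 0 < (Real.exp 1)⁻¹ := by positivity
    nlinarith

lemma im_g {w : ℂ} (hw : w ∈ D) (hp : 0 < w.im) :
    0 < (w + Complex.log w).im ∧ (w + Complex.log w).im < Real.pi := by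
  have hne : w ≠ 0 := by rintro rfl; simp at hp
  have ha : 0 ≤ w.arg := Complex.arg_nonneg_iff.mpr hp.le
  have hb : w.arg ≤ Real.pi := Complex.arg_le_pi w
  have hlt : w.im < Real.pi := lt_of_abs_lt hw.1
  have hg : Complex.exp (w + Complex.log w) = h w := by
    rw [Complex.exp_add, Complex.exp_log hne, h, mul_comm]
  have him : 0 < (h w).im := by
    rw [h_im]; exact mul_pos (Real.exp_pos _) (mul_pos hp hw.2)
  rw [← hg, Complex.exp_im] at him
  have hs := (pos_iff_pos_of_mul_pos him).mp (Real.exp_pos _)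
  have hi : (w + Complex.log w).im = w.im + w.arg := by simp [Complex.log_im]
  rw [hi] at hs ⊢
  refine ⟨by linarith, ?_⟩
  by_contra hc
  push Not at hc
  have : 0 ≤ Real.sin (w.im + w.arg - Real.pi) :=
    Real.sin_nonneg_of_nonneg_of_le_pi (by linarith) (by linarith)
  rw [Real.sin_sub_pi] at this
  linarith

lemma g_inj {a b : ℂ} (ha : 0 < a.im) (hb : 0 < b.im)
    (hab : a + Complex.log a = b + Complex.log b) : a = b := by
  by_contra hne
  have hd : b - a ≠ 0 := sub_ne_zero.mpr (Ne.symm hne)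
  let γ : ℝ → ℂ := fun t => a + t * (b - a)
  have hγ : ∀ t ∈ Set.Icc (0:ℝ) 1, 0 < (γ t).im := by
    intro t ht
    have : (γ t).im = (1 - t) * a.im + t * b.im := by simp [γ]; ring
    rw [this]
    rcases eq_or_lt_of_le ht.1 with h | h
    · rw [← h]; simpa using ha
    · have := mul_pos h hb
      have := mul_nonneg (sub_nonneg.mpr ht.2) ha.le
      linarith
  have hder : ∀ t ∈ Set.Icc (0:ℝ) 1,
      HasDerivAt (fun t => ((γ t + Complex.log (γ t)) / (b - a)).im) ((1 + (γ t)⁻¹).im) t := by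
    intro t ht
    have h1 : HasDerivAt γ (b - a) t := by
      have := ((Complex.ofRealCLM.hasDerivAt (x := t)).mul_const (b - a)).const_add a
      simpa [γ] using this
    have hsl : γ t ∈ Complex.slitPlane := Or.inr (hγ t ht).ne'
    have h2 := h1.clog_real hsl
    have h3 := (h1.add h2).div_const (b - a)
    have h4 := Complex.imCLM.hasFDerivAt.comp_hasDerivAt t h3
    have h5 : (b - a + (b - a) / γ t) / (b - a) = 1 + (γ t)⁻¹ := by
      field_simp
    rw [h5] at h4
    exact h4
  obtain ⟨c, hc, hc0⟩ := exists_hasDerivAt_eq_zero (zero_lt_one)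
    (fun t ht => (hder t ht).continuousAt.continuousWithinAt)
    (by simp [γ, hab]) (fun t ht => hder t (Set.Ioo_subset_Icc_self ht))
  have h1 := hγ c (Set.Ioo_subset_Icc_self hc)
  have h2 : γ c ≠ 0 := by intro h; rw [h] at h1; simp at h1
  simp only [Complex.add_im, Complex.one_im, Complex.inv_im, zero_add] at hc0
  have h3 := Complex.normSq_pos.mpr h2
  have := div_pos h1 h3
  rw [neg_div] at hc0
  linarith

lemma inj_pos {a b : ℂ} (ha : a ∈ D) (hb : b ∈ D) (pa : 0 < a.im) (pb : 0 < b.im)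
    (hab : h a = h b) : a = b := by
  apply g_inj pa pb
  have hane : a ≠ 0 := by rintro rfl; simp at pa
  have hbne : b ≠ 0 := by rintro rfl; simp at pb
  obtain ⟨a1, a2⟩ := im_g ha pa
  obtain ⟨b1, b2⟩ := im_g hb pb
  apply Complex.exp_inj_of_neg_pi_lt_of_le_pi
  any_goals linarith [Real.pi_pos]
  rw [Complex.exp_add, Complex.exp_log hane, Complex.exp_add, Complex.exp_log hbne,
    mul_comm, mul_comm _ b]
  exact hab

lemma conj_D {a : ℂ} (ha : a ∈ D) : (starRingEnd ℂ) a ∈ D := by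
  simpa [D, Real.sinc_neg] using ha

lemma conj_h (a : ℂ) : h ((starRingEnd ℂ) a) = (starRingEnd ℂ) (h a) := by
  simp [h, Complex.exp_conj]

lemma im_pos_iff {a : ℂ} (ha : a ∈ D) : 0 < (h a).im ↔ 0 < a.im := by
  rw [h_im, mul_pos_iff_of_pos_left (Real.exp_pos _), mul_pos_iff_of_pos_right ha.2]

lemma im_zero_iff {a : ℂ} (ha : a ∈ D) : (h a).im = 0 ↔ a.im = 0 := by
  rw [h_im]
  simp [ha.2.ne']

lemma inj : Set.InjOn h D := by
  intro a ha b hb hab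
  rcases lt_trichotomy a.im 0 with h0 | h0 | h0
  · have pa : 0 < ((starRingEnd ℂ) a).im := by simpa using h0
    have hab' : h ((starRingEnd ℂ) a) = h ((starRingEnd ℂ) b) := by rw [conj_h, conj_h, hab]
    have pb := (im_pos_iff (conj_D ha)).mpr pa
    rw [hab', im_pos_iff (conj_D hb)] at pb
    exact (starRingEnd ℂ).injective (inj_pos (conj_D ha) (conj_D hb) pa pb hab')
  · have hb0 : b.im = 0 := by
      rw [← im_zero_iff hb, ← hab, im_zero_iff ha]; exact h0
    have h1 := congrArg Complex.re hab
    rw [h_re, h_re, h0, hb0] at h1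
    simp at h1
    have := real_strictMono.injOn (re_gt ha.1 ha.2).le (re_gt hb.1 hb.2).le
      (show a.re * Real.exp a.re = b.re * Real.exp b.re by linarith)
    exact Complex.ext this (h0.trans hb0.symm)
  · have pb := (im_pos_iff ha).mpr h0
    rw [hab, im_pos_iff hb] at pb
    exact inj_pos ha hb h0 pb hab

lemma isOpen_img : IsOpen (h '' D) := by
  rw [isOpen_iff_mem_nhds]
  rintro _ ⟨w, hw, rfl⟩
  rw [← (strict w).map_nhds_eq (deriv_ne hw)]
  exact image_mem_map (isOpen_D.mem_nhds hw)

lemma preconn : IsPreconnected Om := by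
  have h0 : (0:ℂ) ∈ Om := by
    right; simp; exact Real.exp_pos 1
  have : StarConvex ℝ 0 Om := by
    rw [starConvex_zero_iff]
    intro z hz t ht0 ht1
    rcases eq_or_lt_of_le ht0 with h | h
    · rw [← h]; simpa using h0
    rcases hz with hz | hz
    · left; simpa using ⟨h.ne', hz⟩
    · right
      have : 0 < (Real.exp 1)⁻¹ := by positivity
      simp only [Complex.smul_re, smul_eq_mul]
      nlinarith
  exact (this.isPathConnected h0).isConnected.isPreconnected

lemma norm_le {w : ℂ} (hw : w ∈ D) : ‖w‖ ≤ Real.exp 1 * ‖h w‖ := by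
  have h1 := re_gt hw.1 hw.2
  rw [h, norm_mul, Complex.norm_exp]
  have h2 : 1 ≤ Real.exp 1 * Real.exp w.re := by
    rw [← Real.exp_add]; exact Real.one_le_exp (by linarith)
  nlinarith [norm_nonneg w]

lemma surj : Om ⊆ h '' D := by
  apply preconn.subset_of_closure_inter_subset isOpen_img
  · have : (0:ℂ) ∈ D := by simp [D, Real.pi_pos]
    exact ⟨h 0, maps this, 0, this, rfl⟩
  rintro z ⟨hz, hzO⟩
  obtain ⟨x, hx, hxz⟩ := mem_closure_iff_seq_limit.mp hz
  choose w hwD hwx using hx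
  have hb : Bornology.IsBounded (Set.range x) := Metric.isBounded_range_of_tendsto x hxz
  obtain ⟨C, hC⟩ := hb.exists_norm_le
  have hwb : ∀ n, w n ∈ Metric.closedBall (0:ℂ) (Real.exp 1 * C) := by
    intro n
    rw [mem_closedBall_zero_iff]
    refine (norm_le (hwD n)).trans ?_
    rw [hwx]
    exact mul_le_mul_of_nonneg_left (hC _ ⟨n, rfl⟩) (Real.exp_pos 1).le
  obtain ⟨a, -, φ, hφ, ha⟩ := tendsto_subseq_of_bounded Metric.isBounded_closedBall hwb
  have hha : h a = z := by
    have h1 : Tendsto (fun n => h (w (φ n))) atTop (𝓝 (h a)) :=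
      (strict a).hasDerivAt.continuousAt.tendsto.comp ha
    have h2 : Tendsto (fun n => h (w (φ n))) atTop (𝓝 z) := by
      simp only [hwx]; exact hxz.comp hφ.tendsto_atTop
    exact tendsto_nhds_unique h1 h2
  have c1 : Continuous (fun w : ℂ => |w.im|) := by fun_prop
  have c2 : Continuous (fun w : ℂ => Real.cos w.im + w.re * Real.sinc w.im) := by
    have := Real.continuous_sinc
    fun_prop
  have e1 : |a.im| ≤ Real.pi :=
    le_of_tendsto' ((c1.tendsto a).comp ha) (fun n => (hwD _).1.le)
  have e2 : 0 ≤ Real.cos a.im + a.re * Real.sinc a.im :=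
    ge_of_tendsto' ((c2.tendsto a).comp ha) (fun n => (hwD _).2.le)
  have e3 : |a.im| < Real.pi := by
    refine lt_of_le_of_ne e1 fun he => ?_
    rw [← Real.cos_abs, ← sinc_abs, he, Real.sinc_of_ne_zero Real.pi_ne_zero] at e2
    simp at e2
    linarith
  refine ⟨a, ⟨e3, lt_of_le_of_ne e2 fun he => ?_⟩, hha⟩
  exact bdry e3 he.symm (hha ▸ hzO)

end LW

/-- The principal branch of the Lambert W function extends holomorphically to
`Ω = ℂ \ (−∞, −1/e]`, satisfies `f(z)·e^{f(z)} = z` there, is positive real on the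
positive reals, and maps the open upper half-plane into itself: it is a
Nevanlinna–Pick function, hence a complete Bernstein function. -/
theorem stmt_16 :
    ∃ f : ℂ → ℂ,
      DifferentiableOn ℂ f {z : ℂ | z.im ≠ 0 ∨ -(Real.exp 1)⁻¹ < z.re} ∧
      (∀ z ∈ {z : ℂ | z.im ≠ 0 ∨ -(Real.exp 1)⁻¹ < z.re},
        f z * Complex.exp (f z) = z) ∧
      (∀ x : ℝ, 0 < x → ∃ y : ℝ, 0 < y ∧ f (x : ℂ) = (y : ℂ)) ∧
      (∀ z : ℂ, 0 < z.im → 0 < (f z).im) := by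
  have key : ∀ z : ℂ, ∃ w : ℂ, z ∈ LW.Om → w ∈ LW.D ∧ LW.h w = z := by
    intro z
    by_cases hz : z ∈ LW.Om
    · obtain ⟨w, hw⟩ := LW.surj hz
      exact ⟨w, fun _ => hw⟩
    · exact ⟨0, fun h => absurd h hz⟩
  choose f hf using key
  refine ⟨f, ?_, fun z hz => (hf z hz).2, ?_, ?_⟩
  · intro z hz
    obtain ⟨hD, hh⟩ := hf z hz
    apply DifferentiableAt.differentiableWithinAt
    have hmap := (LW.strict (f z)).map_nhds_eq (LW.deriv_ne hD)
    rw [hh] at hmap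
    have hc : ContinuousAt f z := by
      unfold ContinuousAt
      nth_rewrite 1 [← hmap]
      rw [tendsto_map'_iff]
      refine tendsto_id.congr' ?_
      filter_upwards [LW.isOpen_D.mem_nhds hD] with w hw
      have := hf _ (LW.maps hw)
      exact (LW.inj this.1 hw this.2).symm
    refine (HasDerivAt.of_local_left_inverse hc (LW.strict (f z)).hasDerivAt
      (LW.deriv_ne hD) ?_).differentiableAt
    have : LW.Om ∈ 𝓝 z := by
      rw [← hmap]
      exact mem_map.mpr (mem_of_superset (LW.isOpen_D.mem_nhds hD) fun w hw => LW.maps hw)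
    filter_upwards [this] with y hy
    exact (hf y hy).2
  · intro x hx
    have hO : (x : ℂ) ∈ LW.Om := by
      right
      have : 0 < (Real.exp 1)⁻¹ := by positivity
      simp only [Complex.ofReal_re]
      linarith
    obtain ⟨hD, hh⟩ := hf x hO
    have h0 : (f x).im = 0 := by
      rw [← LW.im_zero_iff hD, hh]; simp
    refine ⟨(f x).re, ?_, Complex.ext (by simp) (by simpa using h0)⟩
    have h1 := congrArg Complex.re hh
    rw [LW.h_re, h0] at h1
    simp at h1
    rw [← h1] at hx
    exact (pos_iff_pos_of_mul_pos hx).mp (Real.exp_pos _)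
  · intro z hz
    obtain ⟨hD, hh⟩ := hf z (Or.inl hz.ne')
    rw [← LW.im_pos_iff hD, hh]
    exact hz
end
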